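/- arXiv:2505.23329 — 9 statements merged into one kernel-verified Lean document; each statement's English description precedes it below -/
import Mathlib

section
/- The continuous solution of the Goursat integral equation is unique: if v₁ and v₂ are continuous functions on D with v₁ = Q − Kv₁ and v₂ = Q − Kv₂ on D, then v₁ = v₂ on D. -/
open MeasureTheory Set Filter

/-- `Q(ξ,η) = -(1/2)∫_{ξ/2}^{η/2} q(α) dα`. -/
noncomputable def Qker (q : ℝ → ℝ) (ξ η : ℝ) : ℝ := -(1/2) * ∫ α in (ξ/2)..(η/2), q α

/-- The Goursat integral operator. -/
noncomputable def Kop (q : ℝ → ℝ) (v : ℝ → ℝ → ℝ) (ξ η : ℝ) : ℝ :=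
  (1/4) * ∫ ξ₁ in (0:ℝ)..ξ, ∫ η₁ in ξ..η, q ((η₁ - ξ₁)/2) * v ξ₁ η₁

/-- The domain `D = {(ξ,η) : 0 ≤ ξ ≤ η}`. -/
def Dset : Set (ℝ × ℝ) := {p | 0 ≤ p.1 ∧ p.1 ≤ p.2}


lemma meas_aux (q : ℝ → ℝ) (hq : Integrable q) (w : ℝ → ℝ → ℝ) (s t : Set ℝ)
    (hs : MeasurableSet s) (ht : MeasurableSet t)
    (hw : ContinuousOn (fun p : ℝ × ℝ => w p.1 p.2) (s ×ˢ t)) :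
    AEStronglyMeasurable (fun a => ∫ b in t, q ((b - a)/2) * w a b) (volume.restrict s) := by
  have hf : AEStronglyMeasurable (fun p : ℝ × ℝ => q ((p.2 - p.1)/2) * w p.1 p.2)
      ((volume.restrict s).prod (volume.restrict t)) := by
    rw [Measure.prod_restrict]
    refine AEStronglyMeasurable.mul ?_ (hw.aestronglyMeasurable (hs.prod ht))
    have h1 : AEStronglyMeasurable (fun x : ℝ => q (x/2)) volume := (hq.comp_div two_ne_zero).1
    have h2 : Measure.QuasiMeasurePreserving (fun p : ℝ × ℝ => p.2 - p.1)
        ((volume : Measure ℝ).prod volume) volume := by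
      have := (quasiMeasurePreserving_sub (volume : Measure ℝ) (volume : Measure ℝ)).comp
        (Measure.measurePreserving_swap (μ := (volume : Measure ℝ)) (ν := (volume : Measure ℝ))).quasiMeasurePreserving
      exact this
    exact (h1.comp_quasiMeasurePreserving h2).restrict
  exact hf.integral_prod_right'

lemma int_aux (q : ℝ → ℝ) (hq : Integrable q) (a : ℝ) :
    Integrable (fun b => q ((b - a)/2)) ∧ ∫ b, |q ((b - a)/2)| = 2 * ∫ x, |q x| := by
  refine ⟨(hq.comp_div two_ne_zero).comp_sub_right a, ?_⟩
  rw [integral_sub_right_eq_self (fun x => |q (x/2)|) a]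
  rw [Measure.integral_comp_div (fun x => |q x|) 2]
  simp

lemma bound_aux (q : ℝ → ℝ) (hq : Integrable q) (f : ℝ → ℝ) (a B : ℝ) (hB : 0 ≤ B) (t : Set ℝ)
    (ht : MeasurableSet t) (hf : ∀ b ∈ t, |f b| ≤ B) :
    |∫ b in t, q ((b - a)/2) * f b| ≤ 2 * (∫ x, |q x|) * B := by
  obtain ⟨h1, h2⟩ := int_aux q hq a
  rw [← h2, ← integral_mul_const]
  have h3 : ‖∫ b in t, q ((b - a)/2) * f b‖ ≤ ∫ b in t, |q ((b - a)/2)| * B := by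
    refine norm_integral_le_of_norm_le (h1.abs.mul_const B).restrict ?_
    filter_upwards [ae_restrict_mem ht] with b hb
    rw [Real.norm_eq_abs, abs_mul]
    exact mul_le_mul_of_nonneg_left (hf b hb) (abs_nonneg _)
  refine h3.trans (setIntegral_le_integral (h1.abs.mul_const B) ?_)
  exact Eventually.of_forall fun b => by positivity

lemma inner_int (q : ℝ → ℝ) (hq : Integrable q) (w : ℝ → ℝ → ℝ) (a : ℝ) (s t : Set ℝ)
    (ht : MeasurableSet t) (ha : a ∈ s) (B : ℝ)
    (hw : ContinuousOn (fun p : ℝ × ℝ => w p.1 p.2) (s ×ˢ t))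
    (hB : ∀ b ∈ t, |w a b| ≤ B) :
    IntegrableOn (fun b => q ((b - a)/2) * w a b) t := by
  refine (int_aux q hq a).1.restrict.mul_bdd (c := B) ?_ ?_
  · refine ContinuousOn.aestronglyMeasurable ?_ ht
    exact hw.comp (f := fun b => (a, b)) (by fun_prop) (fun b hb => ⟨ha, hb⟩)
  · filter_upwards [ae_restrict_mem ht] with b hb using hB b hb

lemma Kop_eq (q q' : ℝ → ℝ) (T : ℝ) (hqq : ∀ x, 0 ≤ x → x ≤ T → q x = q' x) (v : ℝ → ℝ → ℝ)
    (ξ η : ℝ) (h0 : 0 ≤ ξ) (h1 : ξ ≤ η) (h2 : η ≤ T) :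
    Kop q v ξ η = (1/4) * ∫ a in Ioc 0 ξ, ∫ b in Ioc ξ η, q' ((b - a)/2) * v a b := by
  unfold Kop
  rw [intervalIntegral.integral_of_le h0]
  congr 1
  refine setIntegral_congr_fun measurableSet_Ioc fun a ha => ?_
  rw [intervalIntegral.integral_of_le h1]
  refine setIntegral_congr_fun measurableSet_Ioc fun b hb => ?_
  have := ha.1; have := ha.2; have := hb.1; have := hb.2
  rw [hqq _ (by linarith) (by linarith)]

lemma outer_int (q : ℝ → ℝ) (hq : Integrable q) (w : ℝ → ℝ → ℝ) (B : ℝ) (hB0 : 0 ≤ B)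
    (ξ η : ℝ)
    (hw : ContinuousOn (fun p : ℝ × ℝ => w p.1 p.2) (Ioc 0 ξ ×ˢ Ioc ξ η))
    (hB : ∀ a ∈ Ioc 0 ξ, ∀ b ∈ Ioc ξ η, |w a b| ≤ B) :
    IntegrableOn (fun a => ∫ b in Ioc ξ η, q ((b - a)/2) * w a b) (Ioc 0 ξ) := by
  refine IntegrableOn.of_bound (C := 2 * (∫ x, |q x|) * B) (by simp)
    (meas_aux q hq w _ _ measurableSet_Ioc measurableSet_Ioc hw) ?_
  filter_upwards [ae_restrict_mem measurableSet_Ioc] with a ha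
  exact bound_aux q hq (w a) a B hB0 _ measurableSet_Ioc (hB a ha)

lemma bdd_aux (v : ℝ → ℝ → ℝ) (hv : ContinuousOn (fun p : ℝ × ℝ => v p.1 p.2) Dset) (T : ℝ) :
    ∃ B, 0 ≤ B ∧ ∀ a b, 0 ≤ a → a ≤ b → b ≤ T → |v a b| ≤ B := by
  have hc : IsCompact (Dset ∩ Icc (0:ℝ) T ×ˢ Icc (0:ℝ) T) := by
    refine (isCompact_Icc.prod isCompact_Icc).inter_left ?_
    exact (isClosed_le continuous_const continuous_fst).inter
      (isClosed_le continuous_fst continuous_snd)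
  obtain ⟨B, hB⟩ := hc.exists_bound_of_continuousOn (hv.mono inter_subset_left)
  refine ⟨max B 0, le_max_right _ _, fun a b h0 h1 h2 => le_max_of_le_left ?_⟩
  exact hB (a, b) ⟨⟨h0, h1⟩, ⟨h0, h1.trans h2⟩, ⟨h0.trans h1, h2⟩⟩

/-- Uniqueness of the continuous solution of the Goursat integral equation `v = Q - Kv`
on `D`. -/
theorem goursat_unique (q : ℝ → ℝ) (hq : LocallyIntegrableOn q (Set.Ici 0))
    (v₁ v₂ : ℝ → ℝ → ℝ)
    (h₁c : ContinuousOn (fun p : ℝ × ℝ => v₁ p.1 p.2) Dset)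
    (h₂c : ContinuousOn (fun p : ℝ × ℝ => v₂ p.1 p.2) Dset)
    (h₁ : ∀ p ∈ Dset, v₁ p.1 p.2 = Qker q p.1 p.2 - Kop q v₁ p.1 p.2)
    (h₂ : ∀ p ∈ Dset, v₂ p.1 p.2 = Qker q p.1 p.2 - Kop q v₂ p.1 p.2) :
    ∀ p ∈ Dset, v₁ p.1 p.2 = v₂ p.1 p.2 := by
  rintro ⟨x, T⟩ ⟨hx0, hxT⟩
  simp only at hx0 hxT ⊢
  obtain ⟨q', hq'⟩ : ∃ q' : ℝ → ℝ, q' = (Icc 0 T).indicator q := ⟨_, rfl⟩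
  have hqi : Integrable q' := by
    rw [hq', integrable_indicator_iff measurableSet_Icc]
    exact hq.integrableOn_compact_subset (fun y hy => hy.1) isCompact_Icc
  have hqq : ∀ y, 0 ≤ y → y ≤ T → q y = q' y := fun y h0 h1 => by
    rw [hq', indicator_of_mem (show y ∈ Icc 0 T from ⟨h0, h1⟩)]
  obtain ⟨B₁, hB₁0, hB₁⟩ := bdd_aux v₁ h₁c T
  obtain ⟨B₂, hB₂0, hB₂⟩ := bdd_aux v₂ h₂c T
  set C := ∫ y, |q' y| with hC
  have hC0 : 0 ≤ C := integral_nonneg fun y => abs_nonneg _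
  have key : ∀ ξ η, 0 ≤ ξ → ξ ≤ η → η ≤ T → v₁ ξ η - v₂ ξ η =
      -((1/4) * ∫ a in Ioc 0 ξ, ∫ b in Ioc ξ η, q' ((b - a)/2) * (v₁ a b - v₂ a b)) := by
    intro ξ η h0 h1 h2
    have e1 := h₁ (ξ, η) ⟨h0, h1⟩
    have e2 := h₂ (ξ, η) ⟨h0, h1⟩
    simp only at e1 e2
    rw [Kop_eq q q' T hqq _ ξ η h0 h1 h2] at e1 e2
    have hsub : Ioc 0 ξ ×ˢ Ioc ξ η ⊆ Dset := fun p hp =>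
      ⟨hp.1.1.le, hp.1.2.trans hp.2.1.le⟩
    have b1 : ∀ a ∈ Ioc 0 ξ, ∀ b ∈ Ioc ξ η, |v₁ a b| ≤ B₁ := fun a ha b hb =>
      hB₁ a b ha.1.le (ha.2.trans hb.1.le) (hb.2.trans h2)
    have b2 : ∀ a ∈ Ioc 0 ξ, ∀ b ∈ Ioc ξ η, |v₂ a b| ≤ B₂ := fun a ha b hb =>
      hB₂ a b ha.1.le (ha.2.trans hb.1.le) (hb.2.trans h2)
    have i1 := outer_int q' hqi v₁ B₁ hB₁0 ξ η (h₁c.mono hsub) b1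
    have i2 := outer_int q' hqi v₂ B₂ hB₂0 ξ η (h₂c.mono hsub) b2
    have e3 : ∫ a in Ioc 0 ξ, ∫ b in Ioc ξ η, q' ((b - a)/2) * (v₁ a b - v₂ a b) =
        (∫ a in Ioc 0 ξ, ∫ b in Ioc ξ η, q' ((b - a)/2) * v₁ a b) -
        ∫ a in Ioc 0 ξ, ∫ b in Ioc ξ η, q' ((b - a)/2) * v₂ a b := by
      rw [← integral_sub i1 i2]
      refine setIntegral_congr_fun measurableSet_Ioc fun a ha => ?_
      simp only [mul_sub]
      exact integral_sub
        (inner_int q' hqi v₁ a _ _ measurableSet_Ioc ha B₁ (h₁c.mono hsub) (b1 a ha))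
        (inner_int q' hqi v₂ a _ _ measurableSet_Ioc ha B₂ (h₂c.mono hsub) (b2 a ha))
    rw [e3, e1, e2]; ring
  have ind : ∀ n : ℕ, ∀ ξ η, 0 ≤ ξ → ξ ≤ η → η ≤ T →
      |v₁ ξ η - v₂ ξ η| ≤ (B₁ + B₂) * ((C * ξ) ^ n / n.factorial) := by
    intro n
    induction n with
    | zero =>
      intro ξ η h0 h1 h2
      simp only [pow_zero, Nat.factorial_zero, Nat.cast_one, div_one, mul_one]
      exact (abs_sub _ _).trans (add_le_add (hB₁ _ _ h0 h1 h2) (hB₂ _ _ h0 h1 h2))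
    | succ n ih =>
      intro ξ η h0 h1 h2
      rw [key ξ η h0 h1 h2, abs_neg, abs_mul]
      have hb : ‖∫ a in Ioc 0 ξ, ∫ b in Ioc ξ η, q' ((b - a)/2) * (v₁ a b - v₂ a b)‖ ≤
          ∫ a in Ioc 0 ξ, 2 * C * ((B₁ + B₂) * ((C * a) ^ n / n.factorial)) := by
        refine norm_integral_le_of_norm_le ?_ ?_
        · exact (Continuous.integrableOn_Ioc (by fun_prop))
        · filter_upwards [ae_restrict_mem measurableSet_Ioc] with a ha
          refine bound_aux q' hqi (fun b => v₁ a b - v₂ a b) a _ ?_ _ measurableSet_Ioc ?_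
          · have := ha.1.le
            positivity
          · intro b hb
            exact ih a b ha.1.le (ha.2.trans hb.1.le) (hb.2.trans h2)
      have hI : ∫ a in Ioc 0 ξ, 2 * C * ((B₁ + B₂) * ((C * a) ^ n / n.factorial)) =
          2 * ((B₁ + B₂) * ((C * ξ) ^ (n+1) / (n+1).factorial)) := by
        rw [← intervalIntegral.integral_of_le h0]
        have : ∀ a : ℝ, 2 * C * ((B₁ + B₂) * ((C * a) ^ n / n.factorial)) =
          (2 * C * (B₁ + B₂) * C ^ n / n.factorial) * a ^ n := fun a => by
            rw [mul_pow]; ring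
        simp only [this]
        rw [intervalIntegral.integral_const_mul, integral_pow, Nat.factorial_succ]
        have : (n.factorial : ℝ) ≠ 0 := by positivity
        have : (n + 1 : ℝ) ≠ 0 := by positivity
        push_cast
        field_simp
        simp
        ring
      rw [hI, Real.norm_eq_abs] at hb
      have : 0 ≤ (B₁ + B₂) * ((C * ξ) ^ (n+1) / (n+1).factorial) := by positivity
      rw [abs_of_pos (by norm_num : (0:ℝ) < 1/4)]
      linarith
  have hlim : Tendsto (fun n : ℕ => (B₁ + B₂) * ((C * x) ^ n / n.factorial)) atTop (nhds 0) := by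
    simpa using (FloorSemiring.tendsto_pow_div_factorial_atTop (C * x)).const_mul (B₁ + B₂)
  have := ge_of_tendsto' hlim (fun n => ind n x T hx0 hxT le_rfl)
  exact sub_eq_zero.1 (abs_eq_zero.1 (le_antisymm this (abs_nonneg _)))
end

section
/- For every fixed ξ ≥ 0, the function η ↦ v(ξ,η) is locally absolutely continuous on [ξ,∞), and for almost every η > ξ its derivative equals −(1/4) q(η/2) − (1/4)∫₀^{ξ} q((η−ζ)/2) v(ζ,η) dζ. -/
open MeasureTheory Set Filter

/-- `x ↦ q̃(x/2)` is integrable for the truncation `q̃` of `q` to `[0,b/2]`. -/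
lemma trunc_integrable (q : ℝ → ℝ) (hq : LocallyIntegrableOn q (Set.Ici 0)) (b : ℝ) :
    Integrable (fun x : ℝ => (Set.Icc 0 (b/2)).indicator q (x/2)) := by
  have h1 : IntegrableOn q (Set.Icc 0 (b/2)) :=
    hq.integrableOn_compact_subset Set.Icc_subset_Ici_self isCompact_Icc
  have h2 : Integrable ((Set.Icc 0 (b/2)).indicator q) :=
    (integrable_indicator_iff measurableSet_Icc).2 h1
  exact h2.comp_div two_ne_zero

lemma kernel_integrable (q : ℝ → ℝ) (hq : LocallyIntegrableOn q (Set.Ici 0))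
    (v : ℝ → ℝ → ℝ)
    (hvc : ContinuousOn (fun p : ℝ × ℝ => v p.1 p.2) Dset)
    (ξ b : ℝ) :
    IntegrableOn (fun p : ℝ × ℝ => q ((p.1 - p.2)/2) * v p.2 p.1)
      (Set.Icc ξ b ×ˢ Set.Icc 0 ξ) := by
  have hK : IsCompact (Set.Icc ξ b ×ˢ Set.Icc 0 ξ) := isCompact_Icc.prod isCompact_Icc
  have hf : Integrable ((Set.Icc (0:ℝ) ξ).indicator (fun _ => (1:ℝ))) :=
    (integrable_indicator_iff measurableSet_Icc).2
      (integrableOn_const (by simp))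
  have hc := hf.convolution_integrand (ContinuousLinearMap.mul ℝ ℝ) (trunc_integrable q hq b)
  have h1 : IntegrableOn (fun p : ℝ × ℝ => q ((p.1 - p.2)/2)) (Set.Icc ξ b ×ˢ Set.Icc 0 ξ) := by
    refine IntegrableOn.congr_fun (hc.integrableOn) ?_ hK.measurableSet
    rintro ⟨t, z⟩ ⟨ht, hz⟩
    simp only [Set.mem_Icc] at ht hz
    have h2 : (t - z)/2 ∈ Set.Icc 0 (b/2) := ⟨by linarith, by linarith⟩
    have h3 : z ∈ Set.Icc 0 ξ := hz
    simp [Set.indicator_of_mem h2, Set.indicator_of_mem h3]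
  refine h1.mul_continuousOn ?_ hK
  refine hvc.comp (f := fun p : ℝ × ℝ => (p.2, p.1)) (by fun_prop) ?_
  rintro ⟨t, z⟩ ⟨ht, hz⟩
  exact ⟨hz.1, hz.2.trans ht.1⟩

/-- For every fixed `ξ ≥ 0` the map `η ↦ v(ξ,η)` is locally absolutely continuous on
`[ξ,∞)` — i.e. it is the integral of a locally integrable function — and for a.e. `η > ξ`
its derivative is `-(1/4)q(η/2) - (1/4)∫₀^ξ q((η-ζ)/2) v(ζ,η) dζ`. -/
theorem v_locally_AC (q : ℝ → ℝ) (hq : LocallyIntegrableOn q (Set.Ici 0))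
    (v : ℝ → ℝ → ℝ)
    (hvc : ContinuousOn (fun p : ℝ × ℝ => v p.1 p.2) Dset)
    (hv : ∀ p ∈ Dset, v p.1 p.2 = Qker q p.1 p.2 - Kop q v p.1 p.2) :
    ∀ ξ : ℝ, 0 ≤ ξ →
      (∀ b : ℝ, ξ ≤ b →
        IntervalIntegrable
          (fun η => -(1/4) * q (η/2) - (1/4) * ∫ ζ in (0:ℝ)..ξ, q ((η - ζ)/2) * v ζ η)
          volume ξ b) ∧
      (∀ η : ℝ, ξ ≤ η →
        v ξ η = v ξ ξ +
          ∫ t in ξ..η, (-(1/4) * q (t/2) - (1/4) * ∫ ζ in (0:ℝ)..ξ, q ((t - ζ)/2) * v ζ t)) ∧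
      (∀ᵐ η ∂(volume.restrict (Set.Ioi ξ)),
        HasDerivAt (fun s => v ξ s)
          (-(1/4) * q (η/2) - (1/4) * ∫ ζ in (0:ℝ)..ξ, q ((η - ζ)/2) * v ζ η) η) := by
  intro ξ hξ
  have hq1 : ∀ b : ℝ, ξ ≤ b → IntervalIntegrable (fun η => q (η/2)) volume ξ b := by
    intro b hb
    rw [intervalIntegrable_iff_integrableOn_Icc_of_le hb]
    refine IntegrableOn.congr_fun (trunc_integrable q hq b).integrableOn ?_ measurableSet_Icc
    intro t ht
    have h2 : t/2 ∈ Set.Icc 0 (b/2) := ⟨by linarith [ht.1], by linarith [ht.2]⟩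
    simp [Set.indicator_of_mem h2]
  have hsub : ∀ b : ℝ, Set.Ioc ξ b ×ˢ Set.Ioc 0 ξ ⊆ Set.Icc ξ b ×ˢ Set.Icc 0 ξ := fun b =>
    Set.prod_mono Set.Ioc_subset_Icc_self Set.Ioc_subset_Icc_self
  have hker : ∀ b : ℝ, IntegrableOn (fun p : ℝ × ℝ => q ((p.1 - p.2)/2) * v p.2 p.1)
      (Set.Ioc ξ b ×ˢ Set.Ioc 0 ξ) := fun b =>
    (kernel_integrable q hq v hvc ξ b).mono_set (hsub b)
  have hk1 : ∀ b : ℝ, ξ ≤ b → IntervalIntegrable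
      (fun η => ∫ ζ in (0:ℝ)..ξ, q ((η - ζ)/2) * v ζ η) volume ξ b := by
    intro b hb
    rw [intervalIntegrable_iff_integrableOn_Ioc_of_le hb]
    simp only [intervalIntegral.integral_of_le hξ]
    have h := hker b
    rw [IntegrableOn, Measure.volume_eq_prod, ← Measure.prod_restrict] at h
    exact h.integral_prod_left
  have hint : ∀ b : ℝ, ξ ≤ b → IntervalIntegrable
          (fun η => -(1/4) * q (η/2) - (1/4) * ∫ ζ in (0:ℝ)..ξ, q ((η - ζ)/2) * v ζ η)
          volume ξ b := fun b hb =>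
    ((hq1 b hb).const_mul _).sub ((hk1 b hb).const_mul _)
  have hrep : ∀ η : ℝ, ξ ≤ η →
        v ξ η = v ξ ξ +
          ∫ t in ξ..η, (-(1/4) * q (t/2) - (1/4) * ∫ ζ in (0:ℝ)..ξ, q ((t - ζ)/2) * v ζ t) := by
    intro η hη
    have h0 : v ξ ξ = 0 := by
      rw [hv (ξ, ξ) ⟨hξ, le_rfl⟩]
      simp [Qker, Kop]
    have hsw : (∫ t in ξ..η, ∫ ζ in (0:ℝ)..ξ, q ((t - ζ)/2) * v ζ t)
        = ∫ ζ in (0:ℝ)..ξ, ∫ t in ξ..η, q ((t - ζ)/2) * v ζ t := by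
      apply intervalIntegral_intervalIntegral_swap (F := fun t ζ => q ((t - ζ)/2) * v ζ t)
      rw [Set.uIoc_of_le hη, Set.uIoc_of_le hξ]
      exact hker η
    rw [h0, zero_add, hv (ξ, η) ⟨hξ, hη⟩, intervalIntegral.integral_sub
      ((hq1 η hη).const_mul _) ((hk1 η hη).const_mul _), intervalIntegral.integral_const_mul,
      intervalIntegral.integral_const_mul, hsw,
      intervalIntegral.integral_comp_div (fun x => q x) two_ne_zero]
    simp only [Qker, Kop, smul_eq_mul]
    ring
  refine ⟨hint, hrep, ?_⟩
  rw [ae_restrict_iff' measurableSet_Ioi]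
  have hall : ∀ᵐ x : ℝ, ∀ n : ℕ, x ∈ Set.uIcc ξ (ξ + n) → ∀ c ∈ Set.uIcc ξ (ξ + n),
      HasDerivAt (fun x => ∫ t in c..x,
        (-(1/4) * q (t/2) - (1/4) * ∫ ζ in (0:ℝ)..ξ, q ((t - ζ)/2) * v ζ t))
        (-(1/4) * q (x/2) - (1/4) * ∫ ζ in (0:ℝ)..ξ, q ((x - ζ)/2) * v ζ x) x :=
    ae_all_iff.2 fun n =>
      (hint (ξ + n) (by linarith [n.cast_nonneg (α := ℝ)])).ae_hasDerivAt_integral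
  filter_upwards [hall] with x hx hxξ
  have hxξ' : ξ < x := hxξ
  obtain ⟨n, hn⟩ := exists_nat_ge (x - ξ)
  have hmem : x ∈ Set.uIcc ξ (ξ + n) := by
    rw [Set.uIcc_of_le (by linarith)]
    exact ⟨hxξ'.le, by linarith⟩
  refine ((hx n hmem ξ Set.left_mem_uIcc).const_add (v ξ ξ)).congr_of_eventuallyEq ?_
  filter_upwards [Ioi_mem_nhds hxξ'] with s hs
  exact hrep s (le_of_lt hs)
end

section
/- If q is continuous on [0,∞), then the solution v of the Goursat integral equation is continuously differentiable on the interior {(ξ,η) : 0 < ξ < η}, with partial derivatives v_η(ξ,η) = −(1/4) q(η/2) − (1/4)∫₀^{ξ} q((η−ζ)/2) v(ζ,η) dζ and v_ξ(ξ,η) = (1/4) q(ξ/2) − (1/4)∫_{ξ}^{η} q((ζ−ξ)/2) v(ξ,ζ) dζ + (1/4)∫₀^{ξ} q((ξ−ζ)/2) v(ζ,ξ) dζ. -/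
open MeasureTheory Set Filter

/-- The interior region `{(ξ,η) : 0 < ξ < η}`. -/
def Uset : Set (ℝ × ℝ) := {p | 0 < p.1 ∧ p.1 < p.2}

/-- The partial derivative `v_η` formula. -/
noncomputable def vEta (q : ℝ → ℝ) (v : ℝ → ℝ → ℝ) (ξ η : ℝ) : ℝ :=
  -(1/4) * q (η/2) - (1/4) * ∫ ζ in (0:ℝ)..ξ, q ((η - ζ)/2) * v ζ η

/-- The partial derivative `v_ξ` formula. -/
noncomputable def vXi (q : ℝ → ℝ) (v : ℝ → ℝ → ℝ) (ξ η : ℝ) : ℝ :=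
  (1/4) * q (ξ/2) - (1/4) * (∫ ζ in ξ..η, q ((ζ - ξ)/2) * v ξ ζ)
    + (1/4) * ∫ ζ in (0:ℝ)..ξ, q ((ξ - ζ)/2) * v ζ ξ

open Topology

lemma aux_two_partials (f f1 f2 : ℝ → ℝ → ℝ)
    (h1 : ∀ x y, HasDerivAt (fun s => f s y) (f1 x y) x)
    (h2 : ∀ x y, HasDerivAt (fun t => f x t) (f2 x y) y)
    (c1 : Continuous (fun p : ℝ × ℝ => f1 p.1 p.2))
    (c2 : Continuous (fun p : ℝ × ℝ => f2 p.1 p.2)) (p : ℝ × ℝ) :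
    HasFDerivAt (fun p : ℝ × ℝ => f p.1 p.2)
      ((f1 p.1 p.2) • ContinuousLinearMap.fst ℝ ℝ ℝ
        + (f2 p.1 p.2) • ContinuousLinearMap.snd ℝ ℝ ℝ) p := by
  have := hasStrictFDerivAt_uncurry_coprod (𝕜 := ℝ) (u := p) (f := f)
    (f₁ := fun x y => ContinuousLinearMap.toSpanSingleton ℝ (f1 x y))
    (f₂ := fun x y => ContinuousLinearMap.toSpanSingleton ℝ (f2 x y))
    (Eventually.of_forall fun v => (h1 v.1 v.2).hasFDerivAt)
    (Eventually.of_forall fun v => (h2 v.1 v.2).hasFDerivAt)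
    (((ContinuousLinearMap.toSpanSingletonCLE (𝕜 := ℝ) (E := ℝ)).continuous.comp c1).continuousAt)
    (((ContinuousLinearMap.toSpanSingletonCLE (𝕜 := ℝ) (E := ℝ)).continuous.comp c2).continuousAt)
  convert! this.hasFDerivAt using 1
  ext <;> simp [Function.HasUncurry.uncurry]

lemma aux_contDiff (f f1 f2 : ℝ → ℝ → ℝ)
    (h1 : ∀ x y, HasDerivAt (fun s => f s y) (f1 x y) x)
    (h2 : ∀ x y, HasDerivAt (fun t => f x t) (f2 x y) y)
    (c1 : Continuous (fun p : ℝ × ℝ => f1 p.1 p.2))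
    (c2 : Continuous (fun p : ℝ × ℝ => f2 p.1 p.2)) :
    ContDiff ℝ 1 (fun p : ℝ × ℝ => f p.1 p.2) :=
  contDiff_one_iff_hasFDerivAt.2 ⟨_, by fun_prop, aux_two_partials f f1 f2 h1 h2 c1 c2⟩

lemma aux_main (c : ℝ → ℝ) (hc : Continuous c) (F : ℝ → ℝ → ℝ)
    (hF : Continuous (fun p : ℝ × ℝ => F p.1 p.2)) :
    ∃ f1 f2 : ℝ → ℝ → ℝ,
    (∀ x y, f1 x y = (1/4) * c (x/2) - (1/4) * (∫ ζ in x..y, F x ζ)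
      + (1/4) * ∫ ζ in (0:ℝ)..x, F ζ x) ∧
    (∀ x y, f2 x y = -(1/4) * c (y/2) - (1/4) * ∫ ζ in (0:ℝ)..x, F ζ y) ∧
    Continuous (fun p : ℝ × ℝ => f1 p.1 p.2) ∧ Continuous (fun p : ℝ × ℝ => f2 p.1 p.2) ∧
    (∀ x y, HasDerivAt (fun s => -(1/2) * (∫ α in (s/2)..(y/2), c α)
      - (1/4) * ∫ a in (0:ℝ)..s, ∫ b in s..y, F a b) (f1 x y) x) ∧
    (∀ x y, HasDerivAt (fun t => -(1/2) * (∫ α in (x/2)..(t/2), c α)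
      - (1/4) * ∫ a in (0:ℝ)..x, ∫ b in x..t, F a b) (f2 x y) y) := by
  have hFx : ∀ x, Continuous (fun y => F x y) := fun x => by
    exact hF.comp (by fun_prop : Continuous fun y => (x, y))
  have hFy : ∀ y, Continuous (fun x => F x y) := fun y => by
    exact hF.comp (by fun_prop : Continuous fun x => (x, y))
  let G : ℝ → ℝ → ℝ := fun x y => ∫ b in (0:ℝ)..y, F x b
  let L : ℝ → ℝ → ℝ := fun x y => ∫ a in (0:ℝ)..x, F a y
  let H : ℝ → ℝ → ℝ := fun x y => ∫ a in (0:ℝ)..x, G a y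
  have cG : Continuous (fun p : ℝ × ℝ => G p.1 p.2) :=
    intervalIntegral.continuous_parametric_primitive_of_continuous (f := F) hF
  have cL : Continuous (fun p : ℝ × ℝ => L p.1 p.2) := by
    have := intervalIntegral.continuous_parametric_primitive_of_continuous (μ := volume) (a₀ := 0)
      (f := fun y x => F x y) (hF.comp continuous_swap)
    exact this.comp continuous_swap
  have cGx : ∀ x, Continuous (fun y => G x y) := fun x => by
    exact cG.comp (by fun_prop : Continuous fun y => (x, y))
  have cGy : ∀ y, Continuous (fun x => G x y) := fun y => by
    exact cG.comp (by fun_prop : Continuous fun x => (x, y))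
  have cLx : ∀ x, Continuous (fun y => L x y) := fun x => by
    exact cL.comp (by fun_prop : Continuous fun y => (x, y))
  have hH1 : ∀ x y, HasDerivAt (fun s => H s y) (G x y) x := fun x y =>
    (cGy y).integral_hasStrictDerivAt 0 x |>.hasDerivAt
  have hswap : ∀ x y, H x y = ∫ b in (0:ℝ)..y, L x b := fun x y => by
    apply MeasureTheory.intervalIntegral_intervalIntegral_swap
    have : IntegrableOn (fun p : ℝ × ℝ => F p.1 p.2) (uIcc 0 x ×ˢ uIcc 0 y) :=
      hF.continuousOn.integrableOn_compact (isCompact_uIcc.prod isCompact_uIcc)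
    exact this.mono_set (Set.prod_mono uIoc_subset_uIcc uIoc_subset_uIcc)
  have hH2 : ∀ x y, HasDerivAt (fun t => H x t) (L x y) y := fun x y => by
    simp only [hswap]
    exact (cLx x).integral_hasStrictDerivAt 0 y |>.hasDerivAt
  have hsub : ∀ x s y, ∫ b in s..y, F x b = G x y - G x s := fun x s y =>
    (intervalIntegral.integral_interval_sub_left ((hFx x).intervalIntegrable _ _)
      ((hFx x).intervalIntegrable _ _)).symm
  have hK : ∀ x s y, ∫ a in (0:ℝ)..x, ∫ b in s..y, F a b = H x y - H x s := fun x s y => by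
    simp only [hsub]
    exact intervalIntegral.integral_sub ((cGy _).intervalIntegrable _ _)
      ((cGy _).intervalIntegrable _ _)
  let C : ℝ → ℝ := fun t => ∫ α in (0:ℝ)..t, c α
  have hC : ∀ t, HasDerivAt C (c t) t := fun t => (hc.integral_hasStrictDerivAt 0 t).hasDerivAt
  have hC2 : ∀ t, HasDerivAt (fun t => C (t/2)) (c (t/2) * (1/2)) t := fun t =>
    HasDerivAt.comp (h₂ := C) (h := fun t => t / 2) t (hC (t/2)) ((hasDerivAt_id t).div_const 2)
  have hCs : ∀ s t, ∫ α in s..t, c α = C t - C s := fun s t =>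
    (intervalIntegral.integral_interval_sub_left (hc.intervalIntegrable _ _)
      (hc.intervalIntegrable _ _)).symm
  have hdiag : ∀ x, HasDerivAt (fun s => H s s) (G x x + L x x) x := fun x => by
    have h := aux_two_partials H G L hH1 hH2 cG cL (x, x)
    have := h.comp_hasDerivAt_of_eq x ((hasDerivAt_id x).prodMk (hasDerivAt_id x)) rfl
    convert! this using 1
    simp
  refine ⟨fun x y => (1/4) * c (x/2) - (1/4) * (G x y - G x x) + (1/4) * L x x,
    fun x y => -(1/4) * c (y/2) - (1/4) * L x y, ?_, ?_, ?_, ?_, ?_, ?_⟩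
  · intro x y; simp only [hsub, L]
  · intro x y; rfl
  · have e1 : Continuous fun p : ℝ × ℝ => G p.1 p.1 :=
      cG.comp (by fun_prop : Continuous fun p : ℝ × ℝ => (p.1, p.1))
    have e2 : Continuous fun p : ℝ × ℝ => L p.1 p.1 :=
      cL.comp (by fun_prop : Continuous fun p : ℝ × ℝ => (p.1, p.1))
    fun_prop
  · fun_prop
  · intro x y
    simp only [hCs, hK]
    have := (((hC2 x).const_sub (C (y/2))).const_mul (-(1/2))).sub
      (((hH1 x y).sub (hdiag x)).const_mul (1/4))
    convert! this using 1
    ring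
  · intro x y
    simp only [hCs, hK]
    have := (((hC2 y).sub_const (C (x/2))).const_mul (-(1/2))).sub
      (((hH2 x y).sub_const (H x x)).const_mul (1/4))
    convert! this using 1
    ring

/-- If `q` is continuous on `[0,∞)`, the solution `v` of the Goursat integral equation is
continuously differentiable on `{0 < ξ < η}` with the stated partial derivatives. -/
theorem v_C1 (q : ℝ → ℝ) (hq : ContinuousOn q (Set.Ici 0))
    (v : ℝ → ℝ → ℝ)
    (hvc : ContinuousOn (fun p : ℝ × ℝ => v p.1 p.2) Dset)
    (hv : ∀ p ∈ Dset, v p.1 p.2 = Qker q p.1 p.2 - Kop q v p.1 p.2) :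
    ContDiffOn ℝ 1 (fun p : ℝ × ℝ => v p.1 p.2) Uset ∧
    (∀ p ∈ Uset, HasDerivAt (fun t => v p.1 t) (vEta q v p.1 p.2) p.2) ∧
    (∀ p ∈ Uset, HasDerivAt (fun s => v s p.2) (vXi q v p.1 p.2) p.1) ∧
    ContinuousOn (fun p : ℝ × ℝ => vEta q v p.1 p.2) Uset ∧
    ContinuousOn (fun p : ℝ × ℝ => vXi q v p.1 p.2) Uset := by
  have hUD : Uset ⊆ Dset := fun p hp => ⟨hp.1.le, hp.2.le⟩
  have hUo : IsOpen Uset :=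
    (isOpen_lt continuous_const continuous_fst).inter (isOpen_lt continuous_fst continuous_snd)
  let c : ℝ → ℝ := fun t => q (max t 0)
  have hc : Continuous c := hq.comp_continuous (by fun_prop) (fun t => mem_Ici.2 (le_max_right _ _))
  have hcq : ∀ t, 0 ≤ t → c t = q t := fun t ht => by simp only [c, max_eq_left ht]
  let V : ℝ → ℝ → ℝ := fun x y => v (max x 0) (max y (max x 0))
  have hV : Continuous (fun p : ℝ × ℝ => V p.1 p.2) :=
    hvc.comp_continuous (f := fun p : ℝ × ℝ => (max p.1 0, max p.2 (max p.1 0))) (by fun_prop)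
      (fun p => ⟨le_max_right _ _, le_max_right _ _⟩)
  have hVv : ∀ x y, 0 ≤ x → x ≤ y → V x y = v x y := fun x y hx hy => by
    simp only [V, max_eq_left hx, max_eq_left hy]
  let F : ℝ → ℝ → ℝ := fun x y => c ((y - x)/2) * V x y
  have hF : Continuous (fun p : ℝ × ℝ => F p.1 p.2) := by
    simp only [F]; fun_prop
  have hFv : ∀ x y, 0 ≤ x → x ≤ y → F x y = q ((y - x)/2) * v x y := fun x y hx hy => by
    simp only [F]; rw [hVv x y hx hy, hcq _ (by linarith)]
  obtain ⟨f1, f2, e1, e2, c1, c2, d1, d2⟩ := aux_main c hc F hF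
  have E1 : ∀ p ∈ Dset, f1 p.1 p.2 = vXi q v p.1 p.2 := by
    rintro ⟨x, y⟩ ⟨hx, hy⟩
    simp only at hx hy
    rw [e1, vXi, hcq _ (by linarith)]
    congr 2
    · congr 1
      apply intervalIntegral.integral_congr
      intro z hz
      rw [uIcc_of_le hy] at hz
      exact hFv _ _ hx hz.1
    · apply intervalIntegral.integral_congr
      intro z hz
      rw [uIcc_of_le hx] at hz
      exact hFv _ _ hz.1 hz.2
  have E2 : ∀ p ∈ Dset, f2 p.1 p.2 = vEta q v p.1 p.2 := by
    rintro ⟨x, y⟩ ⟨hx, hy⟩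
    simp only at hx hy
    rw [e2, vEta, hcq _ (by linarith)]
    congr 2
    apply intervalIntegral.integral_congr
    intro z hz
    rw [uIcc_of_le hx] at hz
    exact hFv _ _ hz.1 (hz.2.trans hy)
  let W : ℝ → ℝ → ℝ := fun x y => -(1/2) * (∫ α in (x/2)..(y/2), c α)
      - (1/4) * ∫ a in (0:ℝ)..x, ∫ b in x..y, F a b
  have hW : ∀ p ∈ Dset, v p.1 p.2 = W p.1 p.2 := by
    intro p hp
    rw [hv p hp]
    obtain ⟨x, y⟩ := p
    obtain ⟨hx, hy⟩ := hp
    simp only at hx hy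
    simp only [Qker, Kop, W]
    congr 2
    · apply intervalIntegral.integral_congr
      intro z hz
      rw [uIcc_of_le (by linarith)] at hz
      exact (hcq z (by linarith [hz.1])).symm
    · apply intervalIntegral.integral_congr
      intro a ha
      rw [uIcc_of_le hx] at ha
      apply intervalIntegral.integral_congr
      intro b hb
      rw [uIcc_of_le hy] at hb
      exact (hFv a b ha.1 (ha.2.trans hb.1)).symm
  refine ⟨?_, ?_, ?_, ?_, ?_⟩
  · exact (aux_contDiff W f1 f2 d1 d2 c1 c2).contDiffOn.congr fun p hp => hW p (hUD hp)
  · rintro ⟨x, y⟩ hp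
    rw [← E2 _ (hUD hp)]
    refine (d2 x y).congr_of_eventuallyEq ?_
    filter_upwards [lt_mem_nhds hp.2] with t ht
    exact hW (x, t) ⟨hp.1.le, le_of_lt ht⟩
  · rintro ⟨x, y⟩ hp
    rw [← E1 _ (hUD hp)]
    refine (d1 x y).congr_of_eventuallyEq ?_
    filter_upwards [lt_mem_nhds hp.1, gt_mem_nhds hp.2] with s hs hs'
    exact hW (s, y) ⟨le_of_lt hs, le_of_lt hs'⟩
  · exact c2.continuousOn.congr fun p hp => (E2 p (hUD hp)).symm
  · exact c1.continuousOn.congr fun p hp => (E1 p (hUD hp)).symm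
end

section
/- If q is continuously differentiable on [0,∞), then the solution v of the Goursat integral equation is a classical solution of the corresponding Goursat problem: all partial derivatives of v up to second order exist and are continuous on {(ξ,η) : 0 < ξ < η}, the mixed derivative satisfies v_{ξη}(ξ,η) + (1/4) q((η−ξ)/2) v(ξ,η) = 0 there, and the boundary conditions v(η,η) = 0 and v(0,η) = −(1/2)∫₀^{η/2} q(α) dα hold for all η ≥ 0. -/
open MeasureTheory Set Filter

open scoped Topology

/-- Partial derivatives give the total derivative. -/
lemma aux_hasFDerivAt {f fx fy : ℝ → ℝ → ℝ}
    (hx : ∀ x y, HasDerivAt (fun t => f t y) (fx x y) x)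
    (hy : ∀ x y, HasDerivAt (fun t => f x t) (fy x y) y)
    (cx : Continuous (fun p : ℝ × ℝ => fx p.1 p.2))
    (cy : Continuous (fun p : ℝ × ℝ => fy p.1 p.2)) (p : ℝ × ℝ) :
    HasFDerivAt (fun p : ℝ × ℝ => f p.1 p.2)
      (fx p.1 p.2 • ContinuousLinearMap.fst ℝ ℝ ℝ + fy p.1 p.2 • ContinuousLinearMap.snd ℝ ℝ ℝ)
      p := by
  have key := hasStrictFDerivAt_uncurry_coprod (𝕜 := ℝ) (u := p) (f := f)
    (f₁ := fun x y => ContinuousLinearMap.toSpanSingleton ℝ (fx x y))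
    (f₂ := fun x y => ContinuousLinearMap.toSpanSingleton ℝ (fy x y))
    (Eventually.of_forall fun v => (hx v.1 v.2).hasFDerivAt)
    (Eventually.of_forall fun v => (hy v.1 v.2).hasFDerivAt)
    (((ContinuousLinearMap.toSpanSingletonCLE (𝕜 := ℝ) (E := ℝ)).continuous.comp cx).continuousAt)
    (((ContinuousLinearMap.toSpanSingletonCLE (𝕜 := ℝ) (E := ℝ)).continuous.comp cy).continuousAt)
  have e : (fx p.1 p.2 • ContinuousLinearMap.fst ℝ ℝ ℝ + fy p.1 p.2 • ContinuousLinearMap.snd ℝ ℝ ℝ)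
      = (ContinuousLinearMap.toSpanSingleton ℝ (fx p.1 p.2)).coprod
        (ContinuousLinearMap.toSpanSingleton ℝ (fy p.1 p.2)) := by
    ext <;> simp
  rw [e]
  exact key.hasFDerivAt

lemma aux_contDiff_s6 {f fx fy : ℝ → ℝ → ℝ} (n : ℕ)
    (hx : ∀ x y, HasDerivAt (fun t => f t y) (fx x y) x)
    (hy : ∀ x y, HasDerivAt (fun t => f x t) (fy x y) y)
    (cx : ContDiff ℝ n (fun p : ℝ × ℝ => fx p.1 p.2))
    (cy : ContDiff ℝ n (fun p : ℝ × ℝ => fy p.1 p.2)) :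
    ContDiff ℝ (n + 1 : ℕ) (fun p : ℝ × ℝ => f p.1 p.2) := by
  rw [show ((n + 1 : ℕ) : WithTop ℕ∞) = (n : WithTop ℕ∞) + 1 by norm_cast]
  rw [contDiff_succ_iff_hasFDerivAt]
  exact ⟨_, (cx.smul contDiff_const).add (cy.smul contDiff_const),
    aux_hasFDerivAt hx hy cx.continuous cy.continuous⟩

/-- Parametric primitive. -/
noncomputable def auxR (F : ℝ → ℝ → ℝ) (x y : ℝ) : ℝ := ∫ a in (0:ℝ)..x, F a y

lemma auxR_cont {F : ℝ → ℝ → ℝ} (hF : Continuous (fun p : ℝ × ℝ => F p.1 p.2)) :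
    Continuous (fun p : ℝ × ℝ => auxR F p.1 p.2) := by
  unfold auxR
  have h := intervalIntegral.continuous_parametric_intervalIntegral_of_continuous
    (μ := volume) (a₀ := 0) (f := fun (p : ℝ × ℝ) a => F a p.2) (s := fun p => p.1)
    (by exact hF.comp (continuous_snd.prodMk (continuous_snd.comp continuous_fst)))
    continuous_fst
  exact h

lemma auxR_dx {F : ℝ → ℝ → ℝ} (hF : Continuous (fun p : ℝ × ℝ => F p.1 p.2)) (x y : ℝ) :
    HasDerivAt (fun t => auxR F t y) (F x y) x := by
  have hc : Continuous (fun a => F a y) := hF.comp (continuous_id.prodMk continuous_const)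
  exact intervalIntegral.integral_hasDerivAt_right (hc.intervalIntegrable _ _)
    (hc.stronglyMeasurableAtFilter _ _) hc.continuousAt

lemma auxR_dy {F Fy : ℝ → ℝ → ℝ} (hF : Continuous (fun p : ℝ × ℝ => F p.1 p.2))
    (hFy : Continuous (fun p : ℝ × ℝ => Fy p.1 p.2))
    (hd : ∀ x y, HasDerivAt (fun t => F x t) (Fy x y) y) (x y : ℝ) :
    HasDerivAt (fun t => auxR F x t) (auxR Fy x y) y := by
  have hc : ∀ y, Continuous (fun a => F a y) := fun y =>
    hF.comp (continuous_id.prodMk continuous_const)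
  have hc' : ∀ y, Continuous (fun a => Fy a y) := fun y =>
    hFy.comp (continuous_id.prodMk continuous_const)
  obtain ⟨C, hC⟩ := ((isCompact_uIcc (a := (0:ℝ)) (b := x)).prod
    (isCompact_Icc (a := y - 1) (b := y + 1))).exists_bound_of_continuousOn hFy.continuousOn
  refine (intervalIntegral.hasDerivAt_integral_of_dominated_loc_of_deriv_le
    (𝕜 := ℝ) (μ := volume) (a := 0) (b := x) (F := fun y a => F a y) (F' := fun y a => Fy a y)
    (x₀ := y) (s := Icc (y - 1) (y + 1)) (bound := fun _ => C)
    (Icc_mem_nhds (by linarith) (by linarith))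
    (Eventually.of_forall fun y => (hc y).aestronglyMeasurable) ((hc y).intervalIntegrable _ _)
    (hc' y).aestronglyMeasurable ?_ (by simp) ?_).2
  · exact Eventually.of_forall fun a ha z hz => hC (a, z) ⟨uIoc_subset_uIcc ha, hz⟩
  · exact Eventually.of_forall fun a _ z _ => hd a z

lemma auxR_contDiff_one {F : ℝ → ℝ → ℝ} (hF : ContDiff ℝ 1 (fun p : ℝ × ℝ => F p.1 p.2)) :
    ContDiff ℝ 1 (fun p : ℝ × ℝ => auxR F p.1 p.2) := by
  set G : ℝ × ℝ → ℝ := fun p => F p.1 p.2 with hG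
  have hFy : Continuous (fun p : ℝ × ℝ => fderiv ℝ G (p.1, p.2) (0, 1)) :=
    (hF.continuous_fderiv (by simp)).clm_apply continuous_const
  have hd : ∀ x y, HasDerivAt (fun t => F x t) (fderiv ℝ G (x, y) (0, 1)) y := by
    intro x y
    have h1 : HasFDerivAt G (fderiv ℝ G (x, y)) (x, y) :=
      ((hF.differentiable (by simp)) (x, y)).hasFDerivAt
    have h2 : HasDerivAt (fun t : ℝ => (x, t)) ((0:ℝ), (1:ℝ)) y :=
      (hasDerivAt_const y x).prodMk (hasDerivAt_id y)
    exact h1.comp_hasDerivAt y h2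
  have := aux_contDiff_s6 (f := auxR F) (fx := F)
    (fy := auxR (fun x y => fderiv ℝ G (x, y) (0, 1))) 0
    (auxR_dx hF.continuous) (auxR_dy hF.continuous hFy hd)
    (by simpa using hF.continuous) (by simpa using auxR_cont hFy)
  simpa using this

/-- Double primitive. -/
noncomputable def auxS (F : ℝ → ℝ → ℝ) (x y : ℝ) : ℝ :=
  auxR (fun a z => auxR (fun b a => F a b) z a) x y

lemma auxP_cont {F : ℝ → ℝ → ℝ} (hF : Continuous (fun p : ℝ × ℝ => F p.1 p.2)) :
    Continuous (fun p : ℝ × ℝ => auxR (fun b a => F a b) p.2 p.1) :=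
  (auxR_cont (F := fun b a => F a b) (hF.comp continuous_swap)).comp continuous_swap

lemma auxS_dx {F : ℝ → ℝ → ℝ} (hF : Continuous (fun p : ℝ × ℝ => F p.1 p.2)) (x y : ℝ) :
    HasDerivAt (fun t => auxS F t y) (auxR (fun b a => F a b) y x) x :=
  auxR_dx (F := fun a z => auxR (fun b a => F a b) z a) (auxP_cont hF) x y

lemma auxS_dy {F : ℝ → ℝ → ℝ} (hF : Continuous (fun p : ℝ × ℝ => F p.1 p.2)) (x y : ℝ) :
    HasDerivAt (fun t => auxS F x t) (auxR F x y) y :=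
  auxR_dy (F := fun a z => auxR (fun b a => F a b) z a) (Fy := F) (auxP_cont hF) hF
    (fun x y => auxR_dx (F := fun b a => F a b) (hF.comp continuous_swap) y x) x y

lemma auxS_one {F : ℝ → ℝ → ℝ} (hF : Continuous (fun p : ℝ × ℝ => F p.1 p.2)) :
    ContDiff ℝ 1 (fun p : ℝ × ℝ => auxS F p.1 p.2) := by
  have := aux_contDiff_s6 (f := auxS F) 0 (auxS_dx hF) (auxS_dy hF)
    (by simpa using auxP_cont hF) (by simpa using auxR_cont hF)
  simpa using this

lemma auxS_two {F : ℝ → ℝ → ℝ} (hF : ContDiff ℝ 1 (fun p : ℝ × ℝ => F p.1 p.2)) :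
    ContDiff ℝ 2 (fun p : ℝ × ℝ => auxS F p.1 p.2) := by
  have h1 : ContDiff ℝ 1 (fun p : ℝ × ℝ => auxR (fun b a => F a b) p.2 p.1) :=
    (auxR_contDiff_one (F := fun b a => F a b)
      (hF.comp (contDiff_snd.prodMk contDiff_fst))).comp (contDiff_snd.prodMk contDiff_fst)
  have := aux_contDiff_s6 (f := auxS F) 1 (auxS_dx hF.continuous) (auxS_dy hF.continuous)
    (by simpa using h1) (by simpa using auxR_contDiff_one hF)
  simpa using this

/-- `C¹` extension from the half line. -/
lemma aux_extend {q : ℝ → ℝ} (hq : ContDiffOn ℝ 1 q (Set.Ici 0)) :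
    ∃ r : ℝ → ℝ, ContDiff ℝ 1 r ∧ ∀ x, 0 ≤ x → r x = q x := by
  have hc : ContinuousOn (derivWithin q (Ici 0)) (Ici 0) :=
    hq.continuousOn_derivWithin (uniqueDiffOn_Ici 0) le_rfl
  have hg : Continuous (fun t => derivWithin q (Ici 0) (max t 0)) :=
    hc.comp_continuous (by fun_prop) (fun t => mem_Ici.2 (le_max_right _ _))
  have hd : ∀ x, HasDerivAt (fun x => q 0 + ∫ t in (0:ℝ)..x, derivWithin q (Ici 0) (max t 0))
      (derivWithin q (Ici 0) (max x 0)) x := fun x =>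
    (intervalIntegral.integral_hasDerivAt_right (hg.intervalIntegrable _ _)
      (hg.stronglyMeasurableAtFilter _ _) hg.continuousAt).const_add _
  refine ⟨fun x => q 0 + ∫ t in (0:ℝ)..x, derivWithin q (Ici 0) (max t 0), ?_, ?_⟩
  · rw [contDiff_one_iff_deriv]
    refine ⟨fun x => (hd x).differentiableAt, ?_⟩
    rw [show deriv _ = _ from funext fun x => (hd x).deriv]
    exact hg
  · intro x hx
    have := intervalIntegral.integral_eq_sub_of_hasDerivAt_of_le (a := 0) (b := x) hx
      (f := q) (f' := fun t => derivWithin q (Ici 0) (max t 0))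
      (hq.continuousOn.mono Icc_subset_Ici_self) (fun t ht => by
        rw [max_eq_left ht.1.le]
        exact ((hq.differentiableOn one_ne_zero t ht.1.le).hasDerivWithinAt).hasDerivAt
          (Ici_mem_nhds ht.1)) (hg.intervalIntegrable _ _)
    simp only [this]
    ring

lemma aux_Kop {q : ℝ → ℝ} {v F : ℝ → ℝ → ℝ}
    (hF : Continuous (fun p : ℝ × ℝ => F p.1 p.2))
    (h : ∀ a b, 0 ≤ a → a ≤ b → F a b = q ((b - a)/2) * v a b) {x y : ℝ}
    (hx : 0 ≤ x) (hxy : x ≤ y) :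
    Kop q v x y = (1/4) * (auxS F x y - auxS F x x) := by
  have hc : ∀ a, Continuous (fun b => F a b) := fun a =>
    hF.comp (continuous_const.prodMk continuous_id)
  have hP : ∀ z, Continuous (fun a => auxR (fun b a => F a b) z a) := fun z =>
    (auxP_cont hF).comp (continuous_id.prodMk continuous_const)
  unfold Kop auxS
  rw [auxR, auxR, ← intervalIntegral.integral_sub ((hP y).intervalIntegrable _ _)
    ((hP x).intervalIntegrable _ _)]
  congr 1
  refine intervalIntegral.integral_congr fun a ha => ?_
  rw [uIcc_of_le hx] at ha
  simp only [auxR]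
  rw [intervalIntegral.integral_interval_sub_left ((hc a).intervalIntegrable _ _)
    ((hc a).intervalIntegrable _ _)]
  refine intervalIntegral.integral_congr fun b hb => ?_
  rw [uIcc_of_le hxy] at hb
  exact (h a b ha.1 (ha.2.trans hb.1)).symm

lemma aux_Qker {q r : ℝ → ℝ} (hr : Continuous r) (h : ∀ x, 0 ≤ x → r x = q x) {x y : ℝ}
    (hx : 0 ≤ x) (hxy : x ≤ y) :
    Qker q x y = -(1/2) * ((∫ a in (0:ℝ)..(y/2), r a) - ∫ a in (0:ℝ)..(x/2), r a) := by
  unfold Qker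
  rw [intervalIntegral.integral_interval_sub_left (hr.intervalIntegrable _ _)
    (hr.intervalIntegrable _ _)]
  congr 1
  refine intervalIntegral.integral_congr fun a ha => ?_
  rw [uIcc_of_le (by linarith)] at ha
  exact (h a (by linarith [ha.1])).symm

lemma aux_primitive {r : ℝ → ℝ} (hr : ContDiff ℝ 1 r) :
    (∀ x, HasDerivAt (fun x => ∫ a in (0:ℝ)..x, r a) (r x) x) ∧
    ContDiff ℝ 2 (fun x => ∫ a in (0:ℝ)..x, r a) := by
  have hd : ∀ x, HasDerivAt (fun x => ∫ a in (0:ℝ)..x, r a) (r x) x := fun x =>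
    intervalIntegral.integral_hasDerivAt_right (hr.continuous.intervalIntegrable _ _)
      (hr.continuous.stronglyMeasurableAtFilter _ _) hr.continuous.continuousAt
  refine ⟨hd, ?_⟩
  rw [show (2 : WithTop ℕ∞) = 1 + 1 by norm_num, contDiff_succ_iff_deriv]
  refine ⟨fun x => (hd x).differentiableAt, by simp, ?_⟩
  rw [show deriv _ = _ from funext fun x => (hd x).deriv]
  exact hr

/-- If `q` is `C¹` on `[0,∞)`, the solution `v` of the Goursat integral equation is a
classical solution of the Goursat problem: `v` is `C²` on `{0 < ξ < η}`, the mixed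
derivative satisfies `v_{ξη} + (1/4) q((η-ξ)/2) v = 0` there, and the boundary conditions
`v(η,η) = 0`, `v(0,η) = -(1/2)∫₀^{η/2} q` hold for all `η ≥ 0`. -/
theorem v_classical (q : ℝ → ℝ) (hq : ContDiffOn ℝ 1 q (Set.Ici 0))
    (v : ℝ → ℝ → ℝ)
    (hvc : ContinuousOn (fun p : ℝ × ℝ => v p.1 p.2) Dset)
    (hv : ∀ p ∈ Dset, v p.1 p.2 = Qker q p.1 p.2 - Kop q v p.1 p.2) :
    ContDiffOn ℝ 2 (fun p : ℝ × ℝ => v p.1 p.2) Uset ∧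
    (∃ vη : ℝ → ℝ → ℝ,
      (∀ p ∈ Uset, HasDerivAt (fun t => v p.1 t) (vη p.1 p.2) p.2) ∧
      (∀ p ∈ Uset,
        HasDerivAt (fun s => vη s p.2) (-(1/4) * q ((p.2 - p.1)/2) * v p.1 p.2) p.1)) ∧
    (∀ η : ℝ, 0 ≤ η → v η η = 0 ∧ v 0 η = -(1/2) * ∫ α in (0:ℝ)..(η/2), q α) := by
  obtain ⟨r, hr, hrq⟩ := aux_extend hq
  obtain ⟨hAd, hA⟩ := aux_primitive hr
  set A : ℝ → ℝ := fun x => ∫ a in (0:ℝ)..x, r a with hAdef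
  -- continuous extension of `v`
  set u : ℝ → ℝ → ℝ := fun a b => v (max a 0) (max (max a 0) b) with hu
  have huc : Continuous (fun p : ℝ × ℝ => u p.1 p.2) :=
    hvc.comp_continuous (f := fun p : ℝ × ℝ => (max p.1 0, max (max p.1 0) p.2))
      (by fun_prop) (fun p => ⟨le_max_right _ _, le_max_left _ _⟩)
  have huv : ∀ a b, 0 ≤ a → a ≤ b → u a b = v a b := by
    intro a b ha hab
    simp only [hu, max_eq_left ha, max_eq_right hab]
  have hrc : Continuous r := hr.continuous
  -- representation
  have hrep : ∀ F : ℝ → ℝ → ℝ, Continuous (fun p : ℝ × ℝ => F p.1 p.2) →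
      (∀ a b, 0 ≤ a → a ≤ b → F a b = q ((b - a)/2) * v a b) →
      ∀ x y, 0 ≤ x → x ≤ y →
        v x y = -(1/2) * (A (y/2) - A (x/2)) - (1/4) * (auxS F x y - auxS F x x) := by
    intro F hF h x y hx hxy
    rw [← aux_Kop hF h hx hxy, ← aux_Qker hrc hrq hx hxy]
    exact hv (x, y) ⟨hx, hxy⟩
  set F : ℝ → ℝ → ℝ := fun a b => r ((b - a)/2) * u a b with hFdef
  have hF : Continuous (fun p : ℝ × ℝ => F p.1 p.2) := by
    have : Continuous (fun p : ℝ × ℝ => r ((p.2 - p.1)/2)) := hrc.comp (by fun_prop)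
    exact this.mul huc
  have hFv : ∀ a b, 0 ≤ a → a ≤ b → F a b = q ((b - a)/2) * v a b := by
    intro a b ha hab
    simp only [hFdef]
    rw [huv a b ha hab, hrq _ (by linarith)]
  have hQ2 : ContDiff ℝ 2 (fun p : ℝ × ℝ => -(1/2) * (A (p.2/2) - A (p.1/2))) :=
    contDiff_const.mul ((hA.comp (contDiff_snd.div_const 2)).sub
      (hA.comp (contDiff_fst.div_const 2)))
  -- first `C¹` representative
  set w : ℝ → ℝ → ℝ := fun x y =>
    -(1/2) * (A (y/2) - A (x/2)) - (1/4) * (auxS F x y - auxS F x x) with hw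
  have hw1 : ContDiff ℝ 1 (fun p : ℝ × ℝ => w p.1 p.2) := by
    have h1 := auxS_one hF
    have h2 : ContDiff ℝ 1 (fun p : ℝ × ℝ => auxS F p.1 p.1) :=
      h1.comp (contDiff_fst.prodMk contDiff_fst)
    exact (hQ2.of_le one_le_two).sub (contDiff_const.mul (h1.sub h2))
  have hwv : ∀ a b, 0 ≤ a → a ≤ b → v a b = w a b := hrep F hF hFv
  set F₂ : ℝ → ℝ → ℝ := fun a b => r ((b - a)/2) * w a b with hF2def
  have hF2 : ContDiff ℝ 1 (fun p : ℝ × ℝ => F₂ p.1 p.2) := by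
    have : ContDiff ℝ 1 (fun p : ℝ × ℝ => r ((p.2 - p.1)/2)) :=
      hr.comp ((contDiff_snd.sub contDiff_fst).div_const 2)
    exact this.mul hw1
  have hF2v : ∀ a b, 0 ≤ a → a ≤ b → F₂ a b = q ((b - a)/2) * v a b := by
    intro a b ha hab
    simp only [hF2def]
    rw [← hwv a b ha hab, hrq _ (by linarith)]
  refine ⟨?_, ⟨fun x y => -(1/4) * r (y/2) - (1/4) * auxR F x y, ?_, ?_⟩, ?_⟩
  · have h1 := auxS_two hF2
    have h2 : ContDiff ℝ 2 (fun p : ℝ × ℝ => auxS F₂ p.1 p.1) :=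
      h1.comp (contDiff_fst.prodMk contDiff_fst)
    refine (hQ2.sub (contDiff_const.mul (h1.sub h2))).contDiffOn.congr
      (f := fun p : ℝ × ℝ => -(1/2) * (A (p.2/2) - A (p.1/2))
        - (1/4) * (auxS F₂ p.1 p.2 - auxS F₂ p.1 p.1)) ?_
    intro p hp
    exact hrep F₂ hF2.continuous hF2v p.1 p.2 hp.1.le hp.2.le
  · rintro ⟨x, y⟩ ⟨hx, hxy⟩
    simp only at hx hxy ⊢
    have h1 : HasDerivAt (fun t => A (t/2)) (r (y/2) * (1/2)) y :=
      HasDerivAt.comp (h₂ := A) (h := fun t => t / 2) y (hAd (y/2)) ((hasDerivAt_id y).div_const 2)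
    have h2 : HasDerivAt (fun t => w x t)
        (-(1/2) * (r (y/2) * (1/2)) - (1/4) * auxR F x y) y :=
      ((h1.sub_const (A (x/2))).const_mul (-(1/2))).sub
        (((auxS_dy hF x y).sub_const (auxS F x x)).const_mul (1/4))
    have h3 : HasDerivAt (fun t => v x t)
        (-(1/2) * (r (y/2) * (1/2)) - (1/4) * auxR F x y) y := by
      refine h2.congr_of_eventuallyEq ?_
      filter_upwards [Ioi_mem_nhds hxy] with t ht
      exact hwv x t hx.le (le_of_lt ht)
    have e : -(1/4) * r (y/2) - (1/4) * auxR F x y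
        = -(1/2) * (r (y/2) * (1/2)) - (1/4) * auxR F x y := by ring
    rw [e]
    exact h3
  · rintro ⟨x, y⟩ ⟨hx, hxy⟩
    simp only at hx hxy ⊢
    have h1 := ((auxR_dx hF x y).const_mul (1/4)).const_sub (-(1/4) * r (y/2))
    have e : -(1/4) * q ((y - x)/2) * v x y = -(1/4 * F x y) := by
      rw [hFv x y hx.le hxy.le]
      ring
    rw [e]
    exact h1
  · intro η hη
    have h1 := hv (η, η) ⟨hη, le_rfl⟩
    have h2 := hv (0, η) ⟨le_rfl, hη⟩
    simp only [Qker, Kop] at h1 h2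
    constructor
    · simpa using h1
    · simpa using h2
end

section
/- If qₙ (n = 1, 2, …) and q are locally integrable on [0,∞) and ∫₀^{M} |qₙ(α) − q(α)| dα → 0 as n → ∞ for every M > 0, then the solutions converge uniformly on bounded sets: for every N > 0, sup{ |vₙ(ξ,η) − v(ξ,η)| : (ξ,η) ∈ D, η ≤ N } → 0 as n → ∞, where vₙ and v are the unique continuous solutions of the Goursat integral equation for the potentials qₙ and q respectively. -/
open MeasureTheory Set Filter

lemma gs_ii {q : ℝ → ℝ} (hq : LocallyIntegrableOn q (Set.Ici 0)) {a b : ℝ} (ha : 0 ≤ a)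
    (hab : a ≤ b) : IntervalIntegrable q volume a b := by
  rw [intervalIntegrable_iff_integrableOn_Icc_of_le hab]
  exact hq.integrableOn_compact_subset (fun x hx => le_trans ha hx.1) isCompact_Icc

lemma gs_ii_comp {q : ℝ → ℝ} (hq : LocallyIntegrableOn q (Set.Ici 0)) {t a b : ℝ}
    (hta : t ≤ a) (hab : a ≤ b) :
    IntervalIntegrable (fun y => q ((y - t) / 2)) volume a b := by
  have h1 : IntervalIntegrable q volume ((a - t) / 2) ((b - t) / 2) :=
    gs_ii hq (by linarith) (by linarith)
  have h2 := (h1.comp_mul_left (c := (2 : ℝ)⁻¹)).comp_sub_right t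
  convert h2 using 1
  · ext y; congr 1; ring
  · ring
  · ring

lemma gs_integral_comp (q : ℝ → ℝ) (t a b : ℝ) :
    ∫ y in a..b, q ((y - t) / 2) = 2 * ∫ x in ((a - t) / 2)..((b - t) / 2), q x := by
  have := intervalIntegral.integral_comp_div_sub (a := a) (b := b) q (c := 2) (by norm_num) (t / 2)
  rw [smul_eq_mul] at this
  rw [show (a - t) / 2 = a / 2 - t / 2 by ring, show (b - t) / 2 = b / 2 - t / 2 by ring, ← this]
  congr 1; ext y; congr 1; ring

lemma gs_mono {q : ℝ → ℝ} (hq : LocallyIntegrableOn q (Set.Ici 0)) {a b M : ℝ} (ha : 0 ≤ a)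
    (hab : a ≤ b) (hb : b ≤ M) : ∫ x in a..b, |q x| ≤ ∫ x in (0:ℝ)..M, |q x| := by
  apply intervalIntegral.integral_mono_interval ha hab hb
  · exact Eventually.of_forall fun x => abs_nonneg _
  · exact (gs_ii hq le_rfl (by linarith)).abs

lemma gs_inner {q : ℝ → ℝ} (hq : LocallyIntegrableOn q (Set.Ici 0)) {t a b N B : ℝ} (u : ℝ → ℝ)
    (ht : 0 ≤ t) (hta : t ≤ a) (hab : a ≤ b) (hb : b ≤ N) (hB : 0 ≤ B)
    (hu : ∀ y, a ≤ y → y ≤ b → |u y| ≤ B) :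
    |∫ y in a..b, q ((y - t) / 2) * u y| ≤ 2 * (∫ x in (0:ℝ)..(N / 2), |q x|) * B := by
  have h1 : |∫ y in a..b, q ((y - t) / 2) * u y| ≤ ∫ y in a..b, |q ((y - t) / 2)| * B := by
    rw [← Real.norm_eq_abs]
    apply intervalIntegral.norm_integral_le_of_norm_le hab
    · refine Eventually.of_forall fun y hy => ?_
      rw [norm_mul, Real.norm_eq_abs, Real.norm_eq_abs]
      exact mul_le_mul_of_nonneg_left (hu y hy.1.le hy.2) (abs_nonneg _)
    · exact (gs_ii_comp hq hta hab).abs.mul_const B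
  refine h1.trans ?_
  rw [intervalIntegral.integral_mul_const, gs_integral_comp (fun x => |q x|)]
  have := gs_mono hq (a := (a - t) / 2) (b := (b - t) / 2) (M := N / 2) (by linarith)
    (by linarith) (by linarith)
  gcongr

lemma gs_cont_slice {v : ℝ → ℝ → ℝ} (hvc : ContinuousOn (fun p : ℝ × ℝ => v p.1 p.2) Dset)
    {t a b : ℝ} (ht : 0 ≤ t) (hta : t ≤ a) : ContinuousOn (fun y => v t y) (Set.Icc a b) := by
  have : ContinuousOn (fun y : ℝ => (t, y)) (Set.Icc a b) := by fun_prop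
  exact hvc.comp this (fun y hy => ⟨ht, hta.trans hy.1⟩)

lemma gs_inner_ii {q : ℝ → ℝ} (hq : LocallyIntegrableOn q (Set.Ici 0)) {v : ℝ → ℝ → ℝ}
    (hvc : ContinuousOn (fun p : ℝ × ℝ => v p.1 p.2) Dset)
    {t a b : ℝ} (ht : 0 ≤ t) (hta : t ≤ a) (hab : a ≤ b) :
    IntervalIntegrable (fun y => q ((y - t) / 2) * v t y) volume a b := by
  apply (gs_ii_comp hq hta hab).mul_continuousOn
  rw [uIcc_of_le hab]
  exact gs_cont_slice hvc ht hta

lemma gs_compact (N : ℝ) : IsCompact {p ∈ Dset | p.2 ≤ N} := by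
  apply Metric.isCompact_of_isClosed_isBounded
  · have : {p ∈ Dset | p.2 ≤ N} = {p : ℝ × ℝ | 0 ≤ p.1} ∩ {p | p.1 ≤ p.2} ∩ {p | p.2 ≤ N} := by
      ext p; simp [Dset]
    rw [this]
    exact ((isClosed_le (by fun_prop) (by fun_prop)).inter
      (isClosed_le (by fun_prop) (by fun_prop))).inter (isClosed_le (by fun_prop) (by fun_prop))
  · apply (Metric.isBounded_Icc ((0:ℝ), (0:ℝ)) (N, N)).subset
    rintro ⟨x, y⟩ ⟨⟨h1, h2⟩, h3⟩
    simp only at h1 h2 h3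
    exact ⟨⟨h1, h1.trans h2⟩, ⟨h2.trans h3, h3⟩⟩

lemma gs_bdd {v : ℝ → ℝ → ℝ} (hvc : ContinuousOn (fun p : ℝ × ℝ => v p.1 p.2) Dset) (N : ℝ) :
    ∃ B : ℝ, 0 ≤ B ∧ ∀ x y, 0 ≤ x → x ≤ y → y ≤ N → |v x y| ≤ B := by
  obtain ⟨B, hB⟩ := (gs_compact N).exists_bound_of_continuousOn
    (hvc.mono (fun p hp => hp.1))
  refine ⟨max B 0, le_max_right _ _, fun x y h1 h2 h3 => le_trans ?_ (le_max_left _ _)⟩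
  exact hB (x, y) ⟨⟨h1, h2⟩, h3⟩

lemma gs_outer_ii {q : ℝ → ℝ} (hq : LocallyIntegrableOn q (Set.Ici 0)) {v : ℝ → ℝ → ℝ}
    (hvc : ContinuousOn (fun p : ℝ × ℝ => v p.1 p.2) Dset)
    {a b : ℝ} (ha : 0 ≤ a) (hab : a ≤ b) :
    IntervalIntegrable (fun t => ∫ y in a..b, q ((y - t) / 2) * v t y) volume 0 a := by
  obtain ⟨B, hB0, hB⟩ := gs_bdd hvc b
  rw [intervalIntegrable_iff_integrableOn_Ioc_of_le ha]
  have hmeas : AEStronglyMeasurable (fun t => ∫ y in a..b, q ((y - t) / 2) * v t y)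
      (volume.restrict (Ioc 0 a)) := by
    simp_rw [intervalIntegral.integral_of_le hab]
    apply AEStronglyMeasurable.integral_prod_right'
      (f := fun p : ℝ × ℝ => q ((p.2 - p.1) / 2) * v p.1 p.2)
    rw [Measure.prod_restrict]
    have hsub : Ioc 0 a ×ˢ Ioc a b ⊆ Dset := fun p hp => ⟨hp.1.1.le, hp.1.2.trans hp.2.1.le⟩
    have hms : MeasurableSet (Ioc (0:ℝ) a ×ˢ Ioc a b) := measurableSet_Ioc.prod measurableSet_Ioc
    apply AEStronglyMeasurable.mul
    · have h1 : AEStronglyMeasurable ((Set.Ici (0:ℝ)).indicator q) volume :=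
        (aestronglyMeasurable_indicator_iff measurableSet_Ici).2 hq.aestronglyMeasurable
      have h2 : Measure.QuasiMeasurePreserving (fun p : ℝ × ℝ => (p.2 - p.1) / 2)
          (volume.prod volume) volume := by
        have e1 : Measure.QuasiMeasurePreserving (fun p : ℝ × ℝ => p.1 - p.2)
          (volume.prod volume) volume := quasiMeasurePreserving_sub volume volume
        have e2 : Measure.QuasiMeasurePreserving (fun x : ℝ => (-2)⁻¹ * x) volume volume := by
          refine ⟨by fun_prop, ?_⟩
          rw [Real.map_volume_mul_left (by norm_num)]
          exact Measure.smul_absolutelyContinuous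
        convert e2.comp e1 using 1
        ext p; simp only [Function.comp]; ring
      have h3 := (h1.comp_quasiMeasurePreserving h2).restrict (s := Ioc (0:ℝ) a ×ˢ Ioc a b)
      refine h3.congr ?_
      filter_upwards [ae_restrict_mem hms] with p hp
      have : (0:ℝ) ≤ (p.2 - p.1) / 2 := by have := (hsub hp).2; linarith
      simp only [Function.comp]
      rw [indicator_of_mem (show (p.2 - p.1) / 2 ∈ Ici (0:ℝ) from this)]
    · exact (hvc.mono hsub).aestronglyMeasurable hms
  refine Integrable.of_bound hmeas (2 * (∫ x in (0:ℝ)..(b / 2), |q x|) * B) ?_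
  filter_upwards [ae_restrict_mem measurableSet_Ioc] with t ht
  exact gs_inner hq (v t) ht.1.le ht.2 hab le_rfl hB0
    (fun y h1 h2 => hB t y ht.1.le (ht.2.trans h1) h2)

lemma gs_key {p q : ℝ → ℝ} (hp : LocallyIntegrableOn p (Set.Ici 0))
    (hq : LocallyIntegrableOn q (Set.Ici 0)) {u v : ℝ → ℝ → ℝ}
    (huc : ContinuousOn (fun p : ℝ × ℝ => u p.1 p.2) Dset)
    (hvc : ContinuousOn (fun p : ℝ × ℝ => v p.1 p.2) Dset)
    (hu : ∀ z ∈ Dset, u z.1 z.2 = Qker p z.1 z.2 - Kop p u z.1 z.2)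
    (hv : ∀ z ∈ Dset, v z.1 z.2 = Qker q z.1 z.2 - Kop q v z.1 z.2)
    {N B L d : ℝ} (hN : 0 < N) (hB0 : 0 ≤ B)
    (hB : ∀ x y, 0 ≤ x → x ≤ y → y ≤ N → |v x y| ≤ B) (hL : 0 < L)
    (hpL : ∫ x in (0:ℝ)..(N / 2), |p x| ≤ L)
    (hd : ∫ x in (0:ℝ)..(N / 2), |p x - q x| = d) :
    ∀ x y, 0 ≤ x → x ≤ y → y ≤ N →
      |u x y - v x y| ≤ 2 * (d / 2 + N * B * d / 2) * Real.exp (L * N) := by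
  have hpq : LocallyIntegrableOn (fun x => p x - q x) (Set.Ici 0) := hp.sub hq
  have hd0 : 0 ≤ d := by
    rw [← hd]; exact intervalIntegral.integral_nonneg (by linarith) fun _ _ => abs_nonneg _
  have hC0 : 0 ≤ ∫ x in (0:ℝ)..(N / 2), |p x| :=
    intervalIntegral.integral_nonneg (by linarith) fun _ _ => abs_nonneg _
  obtain ⟨z, hz, hmax⟩ := (gs_compact N).exists_isMaxOn
    (f := fun z : ℝ × ℝ => Real.exp (-(L * z.1)) * |u z.1 z.2 - v z.1 z.2|)
    ⟨(0, 0), ⟨⟨le_rfl, le_rfl⟩, hN.le⟩⟩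
    (ContinuousOn.mul (by fun_prop) (((huc.sub hvc).abs).mono fun p hp => hp.1))
  set A := Real.exp (-(L * z.1)) * |u z.1 z.2 - v z.1 z.2| with hA
  have hA0 : 0 ≤ A := by positivity
  have hwA : ∀ x y, 0 ≤ x → x ≤ y → y ≤ N → |u x y - v x y| ≤ A * Real.exp (L * x) := by
    intro x y h1 h2 h3
    have : Real.exp (-(L * x)) * |u x y - v x y| ≤ A := hmax (a := (x, y)) ⟨⟨h1, h2⟩, h3⟩
    calc |u x y - v x y| = (Real.exp (-(L * x)) * |u x y - v x y|) * Real.exp (L * x) := by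
          rw [mul_right_comm, ← Real.exp_add]; simp
      _ ≤ _ := by gcongr
  -- main estimate
  have hmain : ∀ x y, 0 ≤ x → x ≤ y → y ≤ N →
      |u x y - v x y| ≤ (d / 2 + N * B * d / 2) + A / 2 * Real.exp (L * x) := by
    intro x y h1 h2 h3
    have hQ : |Qker p x y - Qker q x y| ≤ d / 2 := by
      unfold Qker
      rw [← mul_sub, ← intervalIntegral.integral_sub (gs_ii hp (by linarith) (by linarith))
        (gs_ii hq (by linarith) (by linarith)), abs_mul]
      have e1 := intervalIntegral.abs_integral_le_integral_abs (f := fun x => p x - q x)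
        (μ := volume) (show x / 2 ≤ y / 2 by linarith)
      have e2 := gs_mono hpq (a := x / 2) (b := y / 2) (M := N / 2) (by linarith)
        (by linarith) (by linarith)
      rw [hd] at e2
      have e3 : |(-(1/2) : ℝ)| = 1 / 2 := by norm_num [abs_div]
      rw [e3]
      linarith
    have hK : |Kop p u x y - Kop q v x y| ≤ N * B * d / 2 + A / 2 * Real.exp (L * x) := by
      unfold Kop
      rw [← mul_sub, ← intervalIntegral.integral_sub (gs_outer_ii hp huc h1 h2)
        (gs_outer_ii hq hvc h1 h2), abs_mul, abs_of_pos (by norm_num : (0:ℝ) < 1 / 4)]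
      have hb : |∫ t in (0:ℝ)..x, ((∫ y in x..y, p ((y - t) / 2) * u t y) -
          ∫ y in x..y, q ((y - t) / 2) * v t y)| ≤
          ∫ t in (0:ℝ)..x, (2 * d * B + 2 * L * A * Real.exp (L * t)) := by
        rw [← Real.norm_eq_abs]
        apply intervalIntegral.norm_integral_le_of_norm_le h1
        · refine Eventually.of_forall fun t ht => ?_
          have ht0 := ht.1.le
          have htx := ht.2
          have i1 := gs_inner_ii hp huc ht0 htx h2
          have i2 := gs_inner_ii hq hvc ht0 htx h2
          have i3 := gs_inner_ii hpq hvc ht0 htx h2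
          have i4 := gs_inner_ii hp (v := fun a b => u a b - v a b) (huc.sub hvc) ht0 htx h2
          rw [← intervalIntegral.integral_sub i1 i2]
          have : (fun s => p ((s - t) / 2) * u t s - q ((s - t) / 2) * v t s) =
              fun s => (p ((s - t) / 2) - q ((s - t) / 2)) * v t s +
                p ((s - t) / 2) * (u t s - v t s) := by ext s; ring
          rw [this, intervalIntegral.integral_add i3 i4]
          refine (norm_add_le _ _).trans (add_le_add ?_ ?_)
          · have := gs_inner hpq (v t) ht0 htx h2 h3 hB0
              (fun s s1 s2 => hB t s ht0 (htx.trans s1) (s2.trans h3))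
            rw [hd] at this
            exact this
          · have := gs_inner hp (fun s => u t s - v t s) ht0 htx h2 h3
              (B := A * Real.exp (L * t)) (by positivity)
              (fun s s1 s2 => hwA t s ht0 (htx.trans s1) (s2.trans h3))
            refine this.trans ?_
            rw [mul_assoc (2 * L)]
            gcongr
        · exact Continuous.intervalIntegrable (by fun_prop) _ _
      have hc : ∫ t in (0:ℝ)..x, (2 * d * B + 2 * L * A * Real.exp (L * t)) =
          2 * d * B * x + 2 * A * (Real.exp (L * x) - 1) := by
        rw [intervalIntegral.integral_add (Continuous.intervalIntegrable (by fun_prop) _ _)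
          (Continuous.intervalIntegrable (by fun_prop) _ _), intervalIntegral.integral_const,
          intervalIntegral.integral_const_mul,
          intervalIntegral.integral_comp_mul_left (fun x => Real.exp x) hL.ne', integral_exp]
        simp only [smul_eq_mul, sub_zero, mul_zero, Real.exp_zero]
        field_simp
      rw [hc] at hb
      have hx : d * B * x ≤ d * B * N := by
        have : x ≤ N := h2.trans h3
        gcongr
      linarith
    have hu' := hu (x, y) ⟨h1, h2⟩
    have hv' := hv (x, y) ⟨h1, h2⟩
    simp only at hu' hv'
    have : u x y - v x y = (Qker p x y - Qker q x y) - (Kop p u x y - Kop q v x y) := by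
      rw [hu', hv']; ring
    rw [this]
    exact (abs_sub _ _).trans (by linarith)
  have hE : 0 ≤ d / 2 + N * B * d / 2 := by positivity
  have hA2 : A ≤ 2 * (d / 2 + N * B * d / 2) := by
    have h := hmain z.1 z.2 hz.1.1 hz.1.2 hz.2
    have h1 : Real.exp (-(L * z.1)) ≤ 1 := by
      rw [Real.exp_le_one_iff]; have := mul_nonneg hL.le hz.1.1; linarith
    have h2 : A ≤ Real.exp (-(L * z.1)) *
        ((d / 2 + N * B * d / 2) + A / 2 * Real.exp (L * z.1)) := by
      rw [hA]; gcongr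
    have h3 : Real.exp (-(L * z.1)) * Real.exp (L * z.1) = 1 := by
      rw [← Real.exp_add]; simp
    have h4 := mul_le_mul_of_nonneg_right h1 hE
    have h5 : Real.exp (-(L * z.1)) *
        ((d / 2 + N * B * d / 2) + A / 2 * Real.exp (L * z.1)) =
        Real.exp (-(L * z.1)) * (d / 2 + N * B * d / 2) +
        A / 2 * (Real.exp (-(L * z.1)) * Real.exp (L * z.1)) := by ring
    rw [h5, h3] at h2
    linarith
  intro x y h1 h2 h3
  refine (hwA x y h1 h2 h3).trans ?_
  have : x ≤ N := h2.trans h3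
  gcongr

/-- If `qₙ → q` in `L¹_loc([0,∞))`, then the solutions of the corresponding Goursat
integral equations converge uniformly on bounded subsets of `D`. -/
theorem goursat_solutions_converge (q : ℝ → ℝ) (qn : ℕ → ℝ → ℝ)
    (hq : LocallyIntegrableOn q (Set.Ici 0))
    (hqn : ∀ n, LocallyIntegrableOn (qn n) (Set.Ici 0))
    (hconv : ∀ M : ℝ, 0 < M →
      Tendsto (fun n => ∫ α in (0:ℝ)..M, |qn n α - q α|) atTop (nhds 0))
    (v : ℝ → ℝ → ℝ) (vn : ℕ → ℝ → ℝ → ℝ)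
    (hvc : ContinuousOn (fun p : ℝ × ℝ => v p.1 p.2) Dset)
    (hv : ∀ p ∈ Dset, v p.1 p.2 = Qker q p.1 p.2 - Kop q v p.1 p.2)
    (hvnc : ∀ n, ContinuousOn (fun p : ℝ × ℝ => vn n p.1 p.2) Dset)
    (hvn : ∀ n, ∀ p ∈ Dset, vn n p.1 p.2 = Qker (qn n) p.1 p.2 - Kop (qn n) (vn n) p.1 p.2) :
    ∀ N : ℝ, 0 < N →
      TendstoUniformlyOn (fun (n : ℕ) (p : ℝ × ℝ) => vn n p.1 p.2)
        (fun p => v p.1 p.2) atTop {p ∈ Dset | p.2 ≤ N} := by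
  intro N hN
  obtain ⟨B, hB0, hB⟩ := gs_bdd hvc N
  set C := ∫ x in (0:ℝ)..(N / 2), |q x| with hC
  have hC0 : 0 ≤ C :=
    intervalIntegral.integral_nonneg (by linarith) fun _ _ => abs_nonneg _
  have hlim := hconv (N / 2) (by linarith)
  set L := C + 1 with hL
  have hlim2 : Tendsto (fun n => 2 * ((∫ α in (0:ℝ)..(N / 2), |qn n α - q α|) / 2 +
      N * B * (∫ α in (0:ℝ)..(N / 2), |qn n α - q α|) / 2) * Real.exp (L * N))
      atTop (nhds 0) := by
    have h := (((hlim.div_const 2).add ((hlim.const_mul (N * B)).div_const 2)).const_mul 2).mul_const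
      (Real.exp (L * N))
    simpa using h
  rw [Metric.tendstoUniformlyOn_iff]
  intro ε hε
  filter_upwards [hlim.eventually_lt_const (zero_lt_one), hlim2.eventually_lt_const hε]
    with n hn1 hn2 z hz
  rw [dist_comm, Real.dist_eq]
  refine lt_of_le_of_lt (gs_key (hqn n) hq (hvnc n) hvc (hvn n) hv hN hB0 hB
    (show 0 < L by linarith) ?_ rfl z.1 z.2 hz.1.1 hz.1.2 hz.2) hn2
  have i1 : IntervalIntegrable (fun x => |qn n x - q x|) volume 0 (N / 2) :=
    (gs_ii ((hqn n).sub hq) le_rfl (by linarith)).abs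
  have i2 : IntervalIntegrable (fun x => |q x|) volume 0 (N / 2) :=
    (gs_ii hq le_rfl (by linarith)).abs
  have h : ∫ x in (0:ℝ)..(N / 2), |qn n x| ≤
      ∫ x in (0:ℝ)..(N / 2), (|qn n x - q x| + |q x|) := by
    apply intervalIntegral.integral_mono_on (by linarith)
      (gs_ii (hqn n) le_rfl (by linarith)).abs (i1.add i2)
    intro x _
    have := abs_add_le (qn n x - q x) (q x)
    simpa using this
  rw [intervalIntegral.integral_add i1 i2] at h
  linarith
end

section
/- If qₙ (n = 1, 2, …) and q are locally integrable on [0,∞) and ∫₀^{M} |qₙ(α) − q(α)| dα → 0 for every M > 0, then the associated response functions converge in L¹ on compacts: ∫₀^{M} |r_{qₙ}(t) − r_q(t)| dt → 0 as n → ∞ for every M > 0. -/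
open MeasureTheory Set Filter

/-- The response function `r_q(t) = -(1/2) q(t/2) - (1/2)∫₀^t q((t-ζ)/2) v_q(ζ,t) dζ`,
expressed through the solution `v` of the Goursat integral equation for `q`. -/
noncomputable def respFun (q : ℝ → ℝ) (v : ℝ → ℝ → ℝ) (t : ℝ) : ℝ :=
  -(1/2) * q (t/2) - (1/2) * ∫ ζ in (0:ℝ)..t, q ((t - ζ)/2) * v ζ t


namespace Goursat

lemma ii_of_li {p : ℝ → ℝ} (hp : LocallyIntegrable p) (a b : ℝ) :
    IntervalIntegrable p volume a b :=
  (hp.integrableOn_isCompact isCompact_uIcc).intervalIntegrable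

lemma ii_shift {p : ℝ → ℝ} (hp : LocallyIntegrable p) (s a b : ℝ) :
    IntervalIntegrable (fun x => p ((x - s) / 2)) volume a b := by
  have h1 : IntervalIntegrable (fun x => p (x / 2)) volume (a - s) (b - s) := by
    have := (ii_of_li hp ((a-s)/2) ((b-s)/2)).comp_mul_left (c := (2:ℝ)⁻¹)
    convert this using 1
    · ext x; congr 1; ring
    · ring
    · ring
  have := h1.comp_sub_right s
  convert this using 1 <;> ring

lemma ii_shift' {p : ℝ → ℝ} (hp : LocallyIntegrable p) (s a b : ℝ) :
    IntervalIntegrable (fun x => p ((s - x) / 2)) volume a b := by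
  have h1 := (ii_shift hp 0 (s - a) (s - b)).comp_sub_left s
  convert h1 using 1 <;> ring_nf

lemma li_abs {p : ℝ → ℝ} (hp : LocallyIntegrable p) : LocallyIntegrable (fun x => |p x|) := by
  intro x
  exact (hp x).norm

lemma int_mono {p : ℝ → ℝ} (hp : LocallyIntegrable p) {a b T : ℝ} (ha : 0 ≤ a) (hab : a ≤ b)
    (hb : b ≤ T) : ∫ x in a..b, |p x| ≤ ∫ x in (0:ℝ)..T, |p x| :=
  intervalIntegral.integral_mono_interval ha hab hb (Eventually.of_forall fun _ => abs_nonneg _)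
    (ii_of_li (li_abs hp) _ _)

lemma inner_bound {p u : ℝ → ℝ} (hp : LocallyIntegrable p) {s a b T c : ℝ} (hc : 0 ≤ c)
    (h0 : 0 ≤ s) (hsa : s ≤ a) (hab : a ≤ b) (hbT : b ≤ T) (hu : ∀ x ∈ Icc a b, |u x| ≤ c) :
    |∫ x in a..b, p ((x - s) / 2) * u x| ≤ 2 * c * ∫ x in (0:ℝ)..T, |p x| := by
  have h1 : ‖∫ x in a..b, p ((x - s) / 2) * u x‖ ≤ ∫ x in a..b, c * |p ((x - s) / 2)| := by
    apply intervalIntegral.norm_integral_le_of_norm_le hab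
    · refine Eventually.of_forall fun x hx => ?_
      rw [norm_mul, mul_comm]
      exact mul_le_mul_of_nonneg_right (hu x (Ioc_subset_Icc_self hx)) (norm_nonneg _)
    · exact (ii_shift (li_abs hp) s a b).const_mul c
  have h2 : ∫ x in a..b, |p ((x - s) / 2)| = 2 * ∫ x in ((a-s)/2)..((b-s)/2), |p x| := by
    rw [intervalIntegral.integral_comp_sub_right (fun x => |p (x / 2)|) s,
      intervalIntegral.integral_comp_div (fun x => |p x|) (two_ne_zero)]
    simp
  rw [intervalIntegral.integral_const_mul, h2] at h1
  refine h1.trans ?_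
  have := int_mono hp (a := (a-s)/2) (b := (b-s)/2) (T := T) (by linarith) (by linarith)
    (by linarith)
  nlinarith

lemma inner_bound' {p u : ℝ → ℝ} (hp : LocallyIntegrable p) {t T c : ℝ} (hc : 0 ≤ c)
    (h0 : 0 ≤ t) (hbT : t ≤ T) (hu : ∀ x ∈ Icc 0 t, |u x| ≤ c) :
    |∫ x in (0:ℝ)..t, p ((t - x) / 2) * u x| ≤ 2 * c * ∫ x in (0:ℝ)..T, |p x| := by
  have h := inner_bound (p := p) (u := fun x => u (t - x)) hp hc le_rfl le_rfl h0 hbT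
    (fun x hx => hu _ ⟨by linarith [hx.2], by linarith [hx.1]⟩)
  have h2 := intervalIntegral.integral_comp_sub_left (a := 0) (b := t)
    (fun x => p ((t - x) / 2) * u x) t
  simp only [sub_sub_cancel, sub_self, sub_zero] at h2 h
  rwa [h2] at h

lemma Kop_bound {p : ℝ → ℝ} {w : ℝ → ℝ → ℝ} (hp : LocallyIntegrable p) {g : ℝ → ℝ}
    (hg : Continuous g) {T ξ η : ℝ} (h0 : 0 ≤ ξ) (h1 : ξ ≤ η) (h2 : η ≤ T)
    (hw : ∀ x y, 0 ≤ x → x ≤ y → y ≤ T → |w x y| ≤ g x) :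
    |Kop p w ξ η| ≤ (1/2) * (∫ x in (0:ℝ)..T, |p x|) * ∫ x in (0:ℝ)..ξ, g x := by
  have h : ‖∫ ξ₁ in (0:ℝ)..ξ, ∫ η₁ in ξ..η, p ((η₁ - ξ₁)/2) * w ξ₁ η₁‖ ≤
      ∫ ξ₁ in (0:ℝ)..ξ, (2 * ∫ x in (0:ℝ)..T, |p x|) * g ξ₁ := by
    apply intervalIntegral.norm_integral_le_of_norm_le h0
    · refine Eventually.of_forall fun x hx => ?_
      have hgx : 0 ≤ g x := (abs_nonneg _).trans (hw x x hx.1.le le_rfl (by linarith [hx.2]))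
      have := inner_bound (p := p) (u := w x) (T := T) hp hgx hx.1.le hx.2 h1 h2
        (fun y hy => hw x y hx.1.le (hx.2.trans hy.1) (hy.2.trans h2))
      rw [Real.norm_eq_abs]
      linarith
    · exact (hg.const_mul _).intervalIntegrable _ _ 
  rw [intervalIntegral.integral_const_mul, Real.norm_eq_abs] at h
  rw [Kop, abs_mul, abs_of_pos (by norm_num : (0:ℝ) < 1/4)]
  linarith

lemma tri_compact (T : ℝ) : IsCompact {p : ℝ × ℝ | 0 ≤ p.1 ∧ p.1 ≤ p.2 ∧ p.2 ≤ T} := by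
  apply (isCompact_Icc (a := (0:ℝ)) (b := T)).prod (isCompact_Icc (a := (0:ℝ)) (b := T))
    |>.of_isClosed_subset
  · exact (isClosed_le continuous_const continuous_fst).inter
      ((isClosed_le continuous_fst continuous_snd).inter (isClosed_le continuous_snd continuous_const))
  · rintro ⟨x, y⟩ ⟨h1, h2, h3⟩
    simp only [mem_prod, mem_Icc] at *
    exact ⟨⟨h1, h2.trans h3⟩, h1.trans h2, h3⟩

lemma gron {p : ℝ → ℝ} {w : ℝ → ℝ → ℝ} (hp : LocallyIntegrable p)
    (hw : Continuous (fun z : ℝ × ℝ => w z.1 z.2)) {T E A : ℝ} (hT : 0 ≤ T) (hE : 0 ≤ E)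
    (hA : ∫ x in (0:ℝ)..T, |p x| ≤ A)
    (h : ∀ x y, 0 ≤ x → x ≤ y → y ≤ T → |w x y| ≤ E + |Kop p w x y|) :
    ∀ x y, 0 ≤ x → x ≤ y → y ≤ T → |w x y| ≤ 2 * E * Real.exp ((A + 1) * T) := by
  have hN : 0 ≤ ∫ x in (0:ℝ)..T, |p x| :=
    intervalIntegral.integral_nonneg hT fun x _ => abs_nonneg _
  obtain ⟨z, ⟨hz1, hz2, hz3⟩, hz⟩ := (tri_compact T).exists_isMaxOn (f := fun z : ℝ × ℝ =>
    |w z.1 z.2| * Real.exp (-((A + 1) * z.1))) ⟨(0, 0), le_rfl, le_rfl, hT⟩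
    (by fun_prop)
  set B := |w z.1 z.2| * Real.exp (-((A + 1) * z.1)) with hB
  have hB0 : 0 ≤ B := by positivity
  have hg : ∀ x y, 0 ≤ x → x ≤ y → y ≤ T → |w x y| ≤ B * Real.exp ((A + 1) * x) := by
    intro x y h1 h2 h3
    have := hz (show (x, y) ∈ _ from ⟨h1, h2, h3⟩)
    simp only [mem_ofPred_eq] at this
    calc |w x y| = |w x y| * Real.exp (-((A + 1) * x)) * Real.exp ((A + 1) * x) := by
          rw [mul_assoc, ← Real.exp_add]; simp
      _ ≤ _ := mul_le_mul_of_nonneg_right this (Real.exp_pos _).le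
  have hl : 0 < A + 1 := by linarith
  have hint : ∫ x in (0:ℝ)..z.1, B * Real.exp ((A + 1) * x)
      ≤ B * (Real.exp ((A + 1) * z.1) / (A + 1)) := by
    rw [intervalIntegral.integral_const_mul]
    apply mul_le_mul_of_nonneg_left _ hB0
    rw [intervalIntegral.integral_comp_mul_left (fun x => Real.exp x) hl.ne', integral_exp]
    simp only [smul_eq_mul, mul_zero, Real.exp_zero]
    rw [div_eq_inv_mul]
    apply mul_le_mul_of_nonneg_left _ (by positivity)
    linarith
  have hk := Kop_bound (g := fun x => B * Real.exp ((A + 1) * x)) hp (by fun_prop) hz1 hz2 hz3 hg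
  have hk2 : |Kop p w z.1 z.2| ≤ (1/2) * (B * Real.exp ((A + 1) * z.1)) := by
    refine hk.trans ?_
    calc _ ≤ (1/2) * (A + 1) * (B * (Real.exp ((A + 1) * z.1) / (A + 1))) := by
          apply mul_le_mul (by linarith) hint _ (by positivity)
          apply intervalIntegral.integral_nonneg hz1
          intro x _; positivity
      _ = _ := by field_simp
  have h3 := h z.1 z.2 hz1 hz2 hz3
  have hee : Real.exp ((A + 1) * z.1) * Real.exp (-((A + 1) * z.1)) = 1 := by
    rw [← Real.exp_add]; simp
  have he1 : Real.exp (-((A + 1) * z.1)) ≤ 1 := by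
    apply Real.exp_le_one_iff.2
    have := mul_nonneg hl.le hz1
    linarith
  have hB2 : B ≤ 2 * E := by
    have : B ≤ (E + (1/2) * (B * Real.exp ((A + 1) * z.1))) * Real.exp (-((A + 1) * z.1)) := by
      rw [hB]
      exact mul_le_mul_of_nonneg_right (by linarith) (Real.exp_pos _).le
    have h5 : (E + (1/2) * (B * Real.exp ((A + 1) * z.1))) * Real.exp (-((A + 1) * z.1))
      = E * Real.exp (-((A + 1) * z.1)) + 1/2 * B := by
      linear_combination (1/2) * B * hee
    have h6 := mul_le_mul_of_nonneg_left he1 hE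
    linarith
  intro x y h1 h2 h3
  refine (hg x y h1 h2 h3).trans (mul_le_mul hB2 ?_ (Real.exp_pos _).le (by linarith))
  apply Real.exp_le_exp.2
  exact mul_le_mul_of_nonneg_left (h2.trans h3) hl.le

lemma tri_bdd {w : ℝ → ℝ → ℝ} (hw : Continuous (fun z : ℝ × ℝ => w z.1 z.2)) (T : ℝ) :
    ∃ C, 0 ≤ C ∧ ∀ x y, 0 ≤ x → x ≤ y → y ≤ T → |w x y| ≤ C := by
  obtain ⟨C, hC⟩ := (tri_compact T).exists_bound_of_continuousOn hw.continuousOn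
  refine ⟨max C 0, le_max_right _ _, fun x y h1 h2 h3 => (hC (x, y) ⟨h1, h2, h3⟩).trans
    (le_max_left _ _)⟩

lemma inner_ii {p : ℝ → ℝ} {w : ℝ → ℝ → ℝ} (hp : LocallyIntegrable p)
    (hw : Continuous (fun z : ℝ × ℝ => w z.1 z.2)) {ξ η : ℝ} (h0 : 0 ≤ ξ) (h1 : ξ ≤ η) :
    IntervalIntegrable (fun x => ∫ y in ξ..η, p ((y - x)/2) * w x y) volume 0 ξ := by
  obtain ⟨C, hC0, hC⟩ := tri_bdd hw η
  rw [intervalIntegrable_iff_integrableOn_Ioc_of_le h0]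
  have hm2 : AEStronglyMeasurable (fun x : ℝ => p (x / 2)) volume := by
    apply hp.aestronglyMeasurable.comp_quasiMeasurePreserving
    refine ⟨by fun_prop, ?_⟩
    have := Real.map_volume_mul_right (a := (2:ℝ)⁻¹) (by norm_num)
    simp only [div_eq_mul_inv]
    rw [this]
    exact Measure.smul_absolutelyContinuous
  have hm : AEStronglyMeasurable (fun z : ℝ × ℝ => p ((z.2 - z.1)/2) * w z.1 z.2)
      (volume.prod volume) := by
    refine AEStronglyMeasurable.mul ?_ hw.aestronglyMeasurable
    have := (quasiMeasurePreserving_sub (volume : Measure ℝ) (volume : Measure ℝ)).comp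
      (Measure.measurePreserving_swap (μ := (volume : Measure ℝ))
        (ν := (volume : Measure ℝ))).quasiMeasurePreserving
    exact hm2.comp_quasiMeasurePreserving this
  have hm3 : AEStronglyMeasurable (fun x => ∫ y in ξ..η, p ((y - x)/2) * w x y)
      (volume.restrict (Ioc 0 ξ)) := by
    simp only [intervalIntegral.integral_of_le h1]
    have h4 : AEStronglyMeasurable (fun z : ℝ × ℝ => p ((z.2 - z.1)/2) * w z.1 z.2)
      ((volume.restrict (Ioc 0 ξ)).prod (volume.restrict (Ioc ξ η))) := by
      rw [Measure.prod_restrict]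
      exact hm.restrict
    exact h4.integral_prod_right'
  refine IntegrableOn.of_bound (by simp) hm3 (2 * C * ∫ x in (0:ℝ)..η, |p x|) ?_
  refine (ae_restrict_iff' measurableSet_Ioc).2 (Eventually.of_forall fun x hx => ?_)
  exact inner_bound (p := p) (u := w x) hp hC0 hx.1.le hx.2 h1 le_rfl
    (fun y hy => hC x y hx.1.le (hx.2.trans hy.1) hy.2)

lemma Kop_split {p q : ℝ → ℝ} {u v : ℝ → ℝ → ℝ} (hp : LocallyIntegrable p)
    (hq : LocallyIntegrable q)
    (hu : Continuous (fun z : ℝ × ℝ => u z.1 z.2)) (hv : Continuous (fun z : ℝ × ℝ => v z.1 z.2))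
    {ξ η : ℝ} (h0 : 0 ≤ ξ) (h1 : ξ ≤ η) :
    Kop p u ξ η - Kop q v ξ η = Kop p (fun x y => u x y - v x y) ξ η
      + Kop (fun x => p x - q x) v ξ η := by
  have hpq : LocallyIntegrable (fun x => p x - q x) := fun x => (hp x).sub (hq x)
  have huv : Continuous (fun z : ℝ × ℝ => u z.1 z.2 - v z.1 z.2) := hu.sub hv
  unfold Kop
  rw [← mul_sub, ← mul_add, ← intervalIntegral.integral_sub (inner_ii hp hu h0 h1)
    (inner_ii hq hv h0 h1), ← intervalIntegral.integral_add
    (inner_ii (w := fun x y => u x y - v x y) hp huv h0 h1) (inner_ii hpq hv h0 h1)]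
  congr 1
  apply intervalIntegral.integral_congr
  intro x _
  have cu : Continuous (u x) := hu.comp (by fun_prop : Continuous fun y : ℝ => (x, y))
  have cv : Continuous (v x) := hv.comp (by fun_prop : Continuous fun y : ℝ => (x, y))
  have i1 := (ii_shift hp x ξ η).mul_continuousOn cu.continuousOn
  have i2 := (ii_shift hq x ξ η).mul_continuousOn cv.continuousOn
  have i3 := (ii_shift hp x ξ η).mul_continuousOn (cu.sub cv).continuousOn
  have i4 := (ii_shift hpq x ξ η).mul_continuousOn cv.continuousOn
  simp only [Pi.sub_apply] at i3 ⊢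
  rw [← intervalIntegral.integral_sub i1 i2, ← intervalIntegral.integral_add i3 i4]
  congr 1
  ext y
  ring

lemma core {p q : ℝ → ℝ} {u v : ℝ → ℝ → ℝ} (hp : LocallyIntegrable p)
    (hq : LocallyIntegrable q)
    (hu : Continuous (fun z : ℝ × ℝ => u z.1 z.2)) (hv : Continuous (fun z : ℝ × ℝ => v z.1 z.2))
    (eu : ∀ z ∈ Dset, u z.1 z.2 = Qker p z.1 z.2 - Kop p u z.1 z.2)
    (ev : ∀ z ∈ Dset, v z.1 z.2 = Qker q z.1 z.2 - Kop q v z.1 z.2)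
    {T C N δ : ℝ} (hT : 0 < T) (hC0 : 0 ≤ C)
    (hC : ∀ x y, 0 ≤ x → x ≤ y → y ≤ T → |v x y| ≤ C)
    (hN : N = ∫ x in (0:ℝ)..T, |q x|) (hδ : δ = ∫ x in (0:ℝ)..T, |p x - q x|) :
    ∫ t in (0:ℝ)..T, |respFun p u t - respFun q v t| ≤
      δ + T * ((N + δ) * (2 * (δ * (1/2 + T * C / 2)) * Real.exp ((N + δ + 1) * T)) + C * δ) := by
  have hpq : LocallyIntegrable (fun x => p x - q x) := fun x => (hp x).sub (hq x)
  have huv : Continuous (fun z : ℝ × ℝ => u z.1 z.2 - v z.1 z.2) := hu.sub hv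
  have hδ0 : 0 ≤ δ := hδ ▸ intervalIntegral.integral_nonneg hT.le fun x _ => abs_nonneg _
  have hN0 : 0 ≤ N := hN ▸ intervalIntegral.integral_nonneg hT.le fun x _ => abs_nonneg _
  have hA : ∫ x in (0:ℝ)..T, |p x| ≤ N + δ := by
    rw [hN, hδ, ← intervalIntegral.integral_add (ii_of_li (li_abs hq) _ _)
      (ii_of_li (li_abs hpq) _ _)]
    apply intervalIntegral.integral_mono_on hT.le (ii_of_li (li_abs hp) _ _)
      ((ii_of_li (li_abs hq) _ _).add (ii_of_li (li_abs hpq) _ _))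
    intro x _
    calc |p x| = |q x + (p x - q x)| := by ring_nf
      _ ≤ _ := abs_add_le _ _
  have key := gron (w := fun x y => u x y - v x y) hp huv (E := δ * (1/2 + T * C / 2)) hT.le
    (by positivity) hA (by
      intro x y h0 h1 h2
      have e1 := eu (x, y) ⟨h0, h1⟩
      have e2 := ev (x, y) ⟨h0, h1⟩
      have e3 := Kop_split hp hq hu hv h0 h1
      simp only at e1 e2
      have e4 : Qker p x y - Qker q x y = -(1/2) * ∫ s in (x/2)..(y/2), (p s - q s) := by
        rw [intervalIntegral.integral_sub (ii_of_li hp _ _) (ii_of_li hq _ _)]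
        unfold Qker; ring
      have e5 : |∫ s in (x/2)..(y/2), (p s - q s)| ≤ δ :=
        (intervalIntegral.abs_integral_le_integral_abs (by linarith)).trans
          (hδ ▸ int_mono hpq (by linarith) (by linarith) (by linarith))
      have e6 : |Qker p x y - Qker q x y| ≤ 1/2 * δ := by
        rw [e4, abs_mul]; norm_num; linarith
      have e7 : |Kop (fun x => p x - q x) v x y| ≤ 1/2 * δ * (T * C) := by
        have := Kop_bound (g := fun _ => C) (w := v) hpq continuous_const h0 h1 h2 hC
        rw [← hδ] at this
        simp only [intervalIntegral.integral_const, smul_eq_mul, sub_zero] at this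
        refine this.trans (mul_le_mul_of_nonneg_left ?_ (by positivity))
        exact mul_le_mul_of_nonneg_right (h1.trans h2) hC0
      have e8 : u x y - v x y = (Qker p x y - Qker q x y)
          - Kop (fun x => p x - q x) v x y - Kop p (fun x y => u x y - v x y) x y := by
        linarith
      calc |u x y - v x y| = _ := congrArg _ e8
        _ ≤ |(Qker p x y - Qker q x y) - Kop (fun x => p x - q x) v x y|
            + |Kop p (fun x y => u x y - v x y) x y| := abs_sub _ _
        _ ≤ |Qker p x y - Qker q x y| + |Kop (fun x => p x - q x) v x y|
            + |Kop p (fun x y => u x y - v x y) x y| := by gcongr; exact abs_sub _ _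
        _ ≤ _ := by linarith)
  set ε := 2 * (δ * (1/2 + T * C / 2)) * Real.exp ((N + δ + 1) * T) with hε
  have hε0 : 0 ≤ ε := by positivity
  have pt : ∀ t ∈ Icc 0 T, |respFun p u t - respFun q v t| ≤
      (1/2) * |p ((t - 0) / 2) - q ((t - 0) / 2)| + ((N + δ) * ε + C * δ) := by
    rintro t ⟨h0, h1⟩
    have cu : Continuous (fun x => u x t) := hu.comp (by fun_prop : Continuous fun y : ℝ => (y, t))
    have cv : Continuous (fun x => v x t) := hv.comp (by fun_prop : Continuous fun y : ℝ => (y, t))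
    have i1 := (ii_shift' hp t 0 t).mul_continuousOn cu.continuousOn
    have i2 := (ii_shift' hq t 0 t).mul_continuousOn cv.continuousOn
    have i3 := (ii_shift' hp t 0 t).mul_continuousOn (cu.sub cv).continuousOn
    have i4 := (ii_shift' hpq t 0 t).mul_continuousOn cv.continuousOn
    simp only [Pi.sub_apply] at i3
    have b1 := inner_bound' (p := p) (u := fun x => u x t - v x t) hp hε0 h0 h1
      (fun x hx => key x t hx.1 hx.2 h1)
    have b2 := inner_bound' (p := fun x => p x - q x) (u := fun x => v x t) hpq hC0 h0 h1
      (fun x hx => hC x t hx.1 hx.2 h1)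
    have e : (∫ x in (0:ℝ)..t, p ((t - x)/2) * u x t) - (∫ x in (0:ℝ)..t, q ((t - x)/2) * v x t)
        = (∫ x in (0:ℝ)..t, p ((t - x)/2) * (u x t - v x t))
          + ∫ x in (0:ℝ)..t, (p ((t - x)/2) - q ((t - x)/2)) * v x t := by
      rw [← intervalIntegral.integral_sub i1 i2, ← intervalIntegral.integral_add i3 i4]
      congr 1
      ext y
      ring
    have b3 : 2 * ε * (∫ x in (0:ℝ)..T, |p x|) ≤ 2 * ε * (N + δ) :=
      mul_le_mul_of_nonneg_left hA (by positivity)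
    rw [← hδ] at b2
    have e2 : respFun p u t - respFun q v t = -(1/2) * (p ((t - 0)/2) - q ((t - 0)/2))
      - (1/2) * ((∫ x in (0:ℝ)..t, p ((t - x)/2) * (u x t - v x t))
          + ∫ x in (0:ℝ)..t, (p ((t - x)/2) - q ((t - x)/2)) * v x t) := by
      rw [← e]; unfold respFun; rw [sub_zero]; ring
    rw [e2]
    simp only [abs_le] at b1 b2 ⊢
    have a1 := le_abs_self (p ((t - 0)/2) - q ((t - 0)/2))
    have a2 := neg_abs_le (p ((t - 0)/2) - q ((t - 0)/2))
    constructor <;> linarith [b1.1, b1.2, b2.1, b2.2]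
  have hi : IntervalIntegrable (fun t => (1/2) * |p ((t - 0) / 2) - q ((t - 0) / 2)|) volume 0 T :=
    (ii_shift (li_abs hpq) 0 0 T).const_mul _
  calc ∫ t in (0:ℝ)..T, |respFun p u t - respFun q v t|
      ≤ ∫ t in (0:ℝ)..T, ((1/2) * |p ((t - 0) / 2) - q ((t - 0) / 2)|
          + ((N + δ) * ε + C * δ)) := by
        have := intervalIntegral.norm_integral_le_of_norm_le (μ := volume) hT.le
          (f := fun t => |respFun p u t - respFun q v t|)
          (Eventually.of_forall fun t ht => (by
            rw [Real.norm_eq_abs, abs_abs]; exact pt t (Ioc_subset_Icc_self ht)))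
          (hi.add (intervalIntegrable_const (c := (N + δ) * ε + C * δ)))
        exact (le_abs_self _).trans this
    _ = (1/2) * (∫ t in (0:ℝ)..T, |p ((t - 0) / 2) - q ((t - 0) / 2)|)
          + T * ((N + δ) * ε + C * δ) := by
        rw [intervalIntegral.integral_add hi intervalIntegrable_const,
          intervalIntegral.integral_const_mul, intervalIntegral.integral_const, sub_zero,
          smul_eq_mul]
    _ ≤ _ := by
        have := (le_abs_self _).trans (inner_bound (p := fun x => |p x - q x|) (u := fun _ => 1)
          (li_abs hpq) zero_le_one le_rfl le_rfl hT.le le_rfl (fun x _ => by simp))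
        simp only [mul_one, abs_abs, ← hδ] at this
        linarith

lemma core_tendsto {q : ℝ → ℝ} {qn : ℕ → ℝ → ℝ} (hq : LocallyIntegrable q)
    (hqn : ∀ n, LocallyIntegrable (qn n))
    (hconv : ∀ M : ℝ, 0 < M →
      Tendsto (fun n => ∫ α in (0:ℝ)..M, |qn n α - q α|) atTop (nhds 0))
    {v : ℝ → ℝ → ℝ} {vn : ℕ → ℝ → ℝ → ℝ}
    (hvc : Continuous (fun p : ℝ × ℝ => v p.1 p.2))
    (hv : ∀ p ∈ Dset, v p.1 p.2 = Qker q p.1 p.2 - Kop q v p.1 p.2)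
    (hvnc : ∀ n, Continuous (fun p : ℝ × ℝ => vn n p.1 p.2))
    (hvn : ∀ n, ∀ p ∈ Dset, vn n p.1 p.2 = Qker (qn n) p.1 p.2 - Kop (qn n) (vn n) p.1 p.2)
    (M : ℝ) (hM : 0 < M) :
      Tendsto (fun n => ∫ t in (0:ℝ)..M, |respFun (qn n) (vn n) t - respFun q v t|)
        atTop (nhds 0) := by
  obtain ⟨C, hC0, hC⟩ := tri_bdd hvc M
  refine squeeze_zero (fun n => intervalIntegral.integral_nonneg hM.le fun x _ => abs_nonneg _)
    (fun n => core (hqn n) hq (hvnc n) hvc (hvn n) hv hM hC0 hC rfl rfl) ?_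
  have hcont : Continuous (fun δ : ℝ => δ + M * (((∫ x in (0:ℝ)..M, |q x|) + δ) *
    (2 * (δ * (1/2 + M * C / 2)) * Real.exp (((∫ x in (0:ℝ)..M, |q x|) + δ + 1) * M)) + C * δ)) := by
    fun_prop
  have := (hcont.tendsto 0).comp (hconv M hM)
  simpa [Function.comp_def] using this

/-- Extension of a potential by zero. -/
noncomputable def extq (q : ℝ → ℝ) : ℝ → ℝ := (Ici (0:ℝ)).indicator q

/-- Continuous extension from the domain. -/
noncomputable def extv (v : ℝ → ℝ → ℝ) : ℝ → ℝ → ℝ :=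
  fun x y => v (max x 0) (max y (max x 0))

lemma extq_eq (q : ℝ → ℝ) {x : ℝ} (hx : 0 ≤ x) : extq q x = q x :=
  indicator_of_mem (mem_Ici.2 hx) q

lemma extv_eq (v : ℝ → ℝ → ℝ) {x y : ℝ} (hx : 0 ≤ x) (hy : x ≤ y) : extv v x y = v x y := by
  simp [extv, max_eq_left hx, max_eq_left hy]

lemma extq_li {q : ℝ → ℝ} (hq : LocallyIntegrableOn q (Ici 0)) : LocallyIntegrable (extq q) := by
  refine (locallyIntegrable_iff).2 fun k hk => ?_
  unfold extq
  rw [integrableOn_indicator_iff measurableSet_Ici]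
  exact hq.integrableOn_compact_subset inter_subset_left (hk.inter_left isClosed_Ici)

lemma extv_cont {v : ℝ → ℝ → ℝ} (hv : ContinuousOn (fun p : ℝ × ℝ => v p.1 p.2) Dset) :
    Continuous (fun p : ℝ × ℝ => extv v p.1 p.2) :=
  hv.comp_continuous (f := fun p : ℝ × ℝ => (max p.1 0, max p.2 (max p.1 0))) (by fun_prop)
    (fun p => ⟨le_max_right _ _, le_max_right _ _⟩)

lemma resp_ext (q : ℝ → ℝ) (v : ℝ → ℝ → ℝ) {t : ℝ} (ht : 0 ≤ t) :
    respFun (extq q) (extv v) t = respFun q v t := by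
  unfold respFun
  rw [extq_eq q (by linarith)]
  congr 2
  apply intervalIntegral.integral_congr
  intro x hx
  rw [uIcc_of_le ht] at hx
  simp only
  rw [extq_eq q (by linarith [hx.2]), extv_eq v hx.1 hx.2]

lemma eqn_ext {q : ℝ → ℝ} {v : ℝ → ℝ → ℝ}
    (h : ∀ p ∈ Dset, v p.1 p.2 = Qker q p.1 p.2 - Kop q v p.1 p.2) :
    ∀ p ∈ Dset, extv v p.1 p.2 =
      Qker (extq q) p.1 p.2 - Kop (extq q) (extv v) p.1 p.2 := by
  rintro ⟨x, y⟩ ⟨h0, h1⟩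
  simp only at h0 h1 ⊢
  have e := h (x, y) ⟨h0, h1⟩
  simp only at e
  rw [extv_eq v h0 h1, e]
  congr 1
  · unfold Qker
    congr 1
    apply intervalIntegral.integral_congr
    intro s hs
    rw [uIcc_of_le (by linarith)] at hs
    exact (extq_eq q (by linarith [hs.1])).symm
  · unfold Kop
    congr 1
    apply intervalIntegral.integral_congr
    intro s hs
    rw [uIcc_of_le h0] at hs
    apply intervalIntegral.integral_congr
    intro r hr
    rw [uIcc_of_le h1] at hr
    simp only
    rw [extq_eq q (by linarith [hs.2, hr.1]), extv_eq v hs.1 (hs.2.trans hr.1)]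

end Goursat

/-- If `qₙ → q` in `L¹_loc([0,∞))`, then the response functions converge in `L¹` on
compacts. -/
theorem response_converges (q : ℝ → ℝ) (qn : ℕ → ℝ → ℝ)
    (hq : LocallyIntegrableOn q (Set.Ici 0))
    (hqn : ∀ n, LocallyIntegrableOn (qn n) (Set.Ici 0))
    (hconv : ∀ M : ℝ, 0 < M →
      Tendsto (fun n => ∫ α in (0:ℝ)..M, |qn n α - q α|) atTop (nhds 0))
    (v : ℝ → ℝ → ℝ) (vn : ℕ → ℝ → ℝ → ℝ)
    (hvc : ContinuousOn (fun p : ℝ × ℝ => v p.1 p.2) Dset)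
    (hv : ∀ p ∈ Dset, v p.1 p.2 = Qker q p.1 p.2 - Kop q v p.1 p.2)
    (hvnc : ∀ n, ContinuousOn (fun p : ℝ × ℝ => vn n p.1 p.2) Dset)
    (hvn : ∀ n, ∀ p ∈ Dset, vn n p.1 p.2 = Qker (qn n) p.1 p.2 - Kop (qn n) (vn n) p.1 p.2) :
    ∀ M : ℝ, 0 < M →
      Tendsto (fun n => ∫ t in (0:ℝ)..M, |respFun (qn n) (vn n) t - respFun q v t|)
        atTop (nhds 0) := by
  intro M hM
  have h := Goursat.core_tendsto (Goursat.extq_li hq) (fun n => Goursat.extq_li (hqn n))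
    (by
      intro M hM
      refine (hconv M hM).congr fun n => ?_
      apply intervalIntegral.integral_congr
      intro x hx
      rw [uIcc_of_le hM.le] at hx
      simp only
      rw [Goursat.extq_eq _ hx.1, Goursat.extq_eq _ hx.1])
    (Goursat.extv_cont hvc) (Goursat.eqn_ext hv) (fun n => Goursat.extv_cont (hvnc n))
    (fun n => Goursat.eqn_ext (hvn n)) M hM
  refine h.congr fun n => ?_
  apply intervalIntegral.integral_congr
  intro t ht
  rw [uIcc_of_le hM.le] at ht
  simp only
  rw [Goursat.resp_ext _ _ ht.1, Goursat.resp_ext _ _ ht.1]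
end

section
/- If q is continuous on [0,∞) and w(x,s) = v(s−x, s+x) for 0 ≤ x ≤ s, then for every t > 0 the one-sided partial derivative w_x(0,t) (the derivative of x ↦ w(x,t) at x = 0 from the right) exists and equals −(1/2) q(t/2) − (1/2)∫₀^{t} q((t−ζ)/2) v(ζ,t) dζ. -/
open MeasureTheory Set Filter

/-- If `H` is continuous then `x ↦ x * H x` has derivative `H 0` at `0`. -/
lemma hasDerivAt_mul_cont (H : ℝ → ℝ) (hH : Continuous H) :
    HasDerivAt (fun x => x * H x) (H 0) 0 := by
  rw [hasDerivAt_iff_tendsto_slope]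
  have h : Tendsto H (nhdsWithin 0 {0}ᶜ) (nhds (H 0)) := (hH.tendsto 0).mono_left nhdsWithin_le_nhds
  refine h.congr' ?_
  filter_upwards [self_mem_nhdsWithin] with x hx
  have hx' : x ≠ 0 := hx
  simp [slope_def_field, hx']

/-- For `q` continuous on `[0,∞)` and `w(x,s) = v(s-x,s+x)`, for every `t > 0` the
one-sided derivative `w_x(0,t)` (from the right) exists and equals
`-(1/2) q(t/2) - (1/2)∫₀^t q((t-ζ)/2) v(ζ,t) dζ`. -/
theorem wx_at_zero (q : ℝ → ℝ) (hq : ContinuousOn q (Set.Ici 0))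
    (v : ℝ → ℝ → ℝ)
    (hvc : ContinuousOn (fun p : ℝ × ℝ => v p.1 p.2) Dset)
    (hv : ∀ p ∈ Dset, v p.1 p.2 = Qker q p.1 p.2 - Kop q v p.1 p.2) :
    ∀ t : ℝ, 0 < t →
      HasDerivWithinAt (fun x => v (t - x) (t + x))
        (-(1/2) * q (t/2) - (1/2) * ∫ ζ in (0:ℝ)..t, q ((t - ζ)/2) * v ζ t)
        (Set.Ici 0) 0 := by
  intro t ht
  have hqe : Continuous (fun s : ℝ => q (max s 0)) :=
    hq.comp_continuous (by fun_prop) (fun s => mem_Ici.2 (le_max_right _ _))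
  have hve : Continuous (fun p : ℝ × ℝ => v (max p.1 0) (max p.2 (max p.1 0))) :=
    hvc.comp_continuous (f := fun p : ℝ × ℝ => (max p.1 0, max p.2 (max p.1 0)))
      (by fun_prop) (fun s => ⟨le_max_right _ _, le_max_right _ _⟩)
  set qe : ℝ → ℝ := fun s => q (max s 0) with hqe_def
  set ve : ℝ × ℝ → ℝ := fun p => v (max p.1 0) (max p.2 (max p.1 0)) with hve_def
  have qe_eq : ∀ s, 0 ≤ s → qe s = q s := fun s hs => by simp [hqe_def, hs]
  have ve_eq : ∀ a b, 0 ≤ a → a ≤ b → ve (a, b) = v a b := fun a b ha hab => by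
    simp [hve_def, ha, hab]
  let F : ℝ → ℝ → ℝ := fun a b => qe ((b - a)/2) * ve (a, b)
  have F_eq : ∀ a b, 0 ≤ a → a ≤ b → F a b = q ((b - a)/2) * v a b := fun a b ha hab => by
    simp only [F]
    rw [qe_eq _ (by linarith), ve_eq a b ha hab]
  have hF : Continuous (fun p : ℝ × ℝ => F p.1 p.2) := by
    simp only [F]
    fun_prop
  let A : ℝ → ℝ := fun x => ∫ u in (-(1/2) : ℝ)..(1/2), qe (t/2 + x * u)
  let J : ℝ × ℝ → ℝ := fun p => ∫ u in (-1 : ℝ)..1, F p.2 (t + p.1 * u)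
  let B : ℝ → ℝ := fun x => ∫ a in (0:ℝ)..(t - x), J (x, a)
  have hA : Continuous A := by
    apply intervalIntegral.continuous_parametric_intervalIntegral_of_continuous'
      (f := fun x u => qe (t/2 + x * u))
    simp only [Function.uncurry_def]
    fun_prop
  have hJ : Continuous J := by
    apply intervalIntegral.continuous_parametric_intervalIntegral_of_continuous'
      (f := fun (p : ℝ × ℝ) u => F p.2 (t + p.1 * u))
    exact hF.comp (g := fun p : ℝ × ℝ => F p.1 p.2)
      (f := fun r : (ℝ × ℝ) × ℝ => (r.1.2, t + r.1.1 * r.2)) (by fun_prop)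
  have hB : Continuous B := by
    apply intervalIntegral.continuous_parametric_intervalIntegral_of_continuous
      (f := fun x a => J (x, a))
    · exact hJ
    · fun_prop
  let H : ℝ → ℝ := fun x => -(1/2) * A x - (1/4) * B x
  have hH : Continuous H := by
    simp only [H]
    fun_prop
  have hder := (hasDerivAt_mul_cont H hH).hasDerivWithinAt (s := Set.Ici 0)
  have hH0 : H 0 = -(1/2) * q (t/2) - (1/2) * ∫ ζ in (0:ℝ)..t, q ((t - ζ)/2) * v ζ t := by
    have h1 : A 0 = q (t/2) := by
      simp only [A, zero_mul, add_zero, intervalIntegral.integral_const, smul_eq_mul]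
      rw [qe_eq _ (by linarith)]
      ring
    have h2 : B 0 = 2 * ∫ ζ in (0:ℝ)..t, q ((t - ζ)/2) * v ζ t := by
      simp only [B, J, zero_mul, add_zero, sub_zero, intervalIntegral.integral_const, smul_eq_mul]
      rw [← intervalIntegral.integral_const_mul]
      apply intervalIntegral.integral_congr
      intro a ha
      rw [uIcc_of_le ht.le] at ha
      simp only
      rw [F_eq a t ha.1 ha.2]
      ring
    simp only [H]
    rw [h1, h2]
    ring
  have key : ∀ x, 0 ≤ x → x ≤ t → v (t - x) (t + x) = x * H x := by
    intro x hx hxt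
    have h0 := hv (t - x, t + x) ⟨by simpa using hxt, by simp only; linarith⟩
    simp only at h0
    rw [h0]
    have h1 : (∫ α in ((t - x)/2)..((t + x)/2), q α) = x * A x := by
      simp only [A]
      rw [intervalIntegral.mul_integral_comp_add_mul]
      rw [show t/2 + x * -(1/2) = (t - x)/2 by ring, show t/2 + x * (1/2) = (t + x)/2 by ring]
      apply intervalIntegral.integral_congr
      intro a ha
      rw [uIcc_of_le (by linarith)] at ha
      exact (qe_eq a (by linarith [ha.1])).symm
    have h2 : (∫ ξ₁ in (0:ℝ)..(t - x), ∫ η₁ in (t - x)..(t + x), q ((η₁ - ξ₁)/2) * v ξ₁ η₁)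
        = x * B x := by
      simp only [B]
      rw [← intervalIntegral.integral_const_mul]
      apply intervalIntegral.integral_congr
      intro a ha
      rw [uIcc_of_le (by linarith)] at ha
      simp only [J]
      rw [intervalIntegral.mul_integral_comp_add_mul (f := fun b => F a b)]
      rw [show t + x * -1 = t - x by ring, show t + x * 1 = t + x by ring]
      apply intervalIntegral.integral_congr
      intro b hb
      rw [uIcc_of_le (by linarith)] at hb
      exact (F_eq a b ha.1 (ha.2.trans hb.1)).symm
    simp only [Qker, Kop, H]
    rw [h1, h2]
    ring
  rw [← hH0]
  refine hder.congr_of_eventuallyEq ?_ (key 0 le_rfl ht.le)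
  filter_upwards [self_mem_nhdsWithin, mem_nhdsWithin_of_mem_nhds (Iic_mem_nhds ht)] with x hx hxt
  exact key x hx hxt
end

section
/- For the solution u(x,t) = f(t−x) + ∫ₓ^{t} w(x,s) f(t−s) ds (0 ≤ x ≤ t), extended by 0 for x > t, the boundary derivative admits the representation u_x(0,t) = −f'(t) + ∫₀^{t} w_x(0,s) f(t−s) ds for every t > 0, where u_x(0,t) denotes the one-sided derivative of x ↦ u(x,t) at x = 0 from the right. -/
open MeasureTheory Set Filter

/-- The solution of the wave equation:
`u(x,t) = f(t-x) + ∫ₓᵗ w(x,s) f(t-s) ds` for `x ≤ t` and `u(x,t) = 0` for `x > t`. -/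
noncomputable def usol (f : ℝ → ℝ) (w : ℝ → ℝ → ℝ) (x t : ℝ) : ℝ :=
  if x ≤ t then f (t - x) + ∫ s in x..t, w x s * f (t - s) else 0

theorem Dset_convex : Convex ℝ Dset := by
  intro p hp r hr a b ha hb hab
  obtain ⟨h1, h2⟩ := hp
  obtain ⟨h3, h4⟩ := hr
  refine ⟨?_, ?_⟩
  · simp only [Prod.fst_add, Prod.smul_fst, smul_eq_mul]; positivity
  · simp only [Prod.fst_add, Prod.smul_fst, smul_eq_mul, Prod.snd_add, Prod.smul_snd]
    have := mul_le_mul_of_nonneg_left h2 ha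
    have := mul_le_mul_of_nonneg_left h4 hb
    linarith

theorem Dset_closed : IsClosed Dset :=
  (isClosed_le continuous_const continuous_fst).inter (isClosed_le continuous_fst continuous_snd)

theorem Dset_unique : UniqueDiffOn ℝ Dset := by
  apply uniqueDiffOn_convex Dset_convex
  refine ⟨((1 : ℝ), (2 : ℝ)), ?_⟩
  rw [mem_interior]
  refine ⟨{p | 0 < p.1 ∧ p.1 < p.2}, fun p hp => ⟨hp.1.le, hp.2.le⟩, ?_, by simp⟩
  exact (isOpen_lt continuous_const continuous_fst).inter (isOpen_lt continuous_fst continuous_snd)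

theorem w_bound (w : ℝ → ℝ → ℝ)
    (hw : ContDiffOn ℝ 2 (fun p : ℝ × ℝ => w p.1 p.2) Dset)
    (hw0 : ∀ s : ℝ, 0 ≤ s → w 0 s = 0) (t : ℝ) :
    ∃ C : ℝ, ∀ x s : ℝ, 0 ≤ x → x ≤ s → s ≤ t → |w x s| ≤ C * x := by
  have hcont := hw.continuousOn_fderivWithin Dset_unique (by norm_num)
  have hKsub : Dset ∩ {p | p.2 ≤ t} ⊆ Dset := inter_subset_left
  have hK : IsCompact (Dset ∩ {p : ℝ × ℝ | p.2 ≤ t}) := by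
    apply (isCompact_Icc (a := ((0:ℝ), (0:ℝ))) (b := (t, t))).of_isClosed_subset
    · exact Dset_closed.inter (isClosed_le continuous_snd continuous_const)
    · rintro ⟨x, s⟩ ⟨⟨h1, h2⟩, h3⟩
      simp only [mem_ofPred_eq] at h1 h2 h3
      exact ⟨⟨h1, h1.trans h2⟩, ⟨h2.trans h3, h3⟩⟩
  have hKc : Convex ℝ (Dset ∩ {p : ℝ × ℝ | p.2 ≤ t}) :=
    Dset_convex.inter (convex_halfSpace_le (IsLinearMap.mk (fun _ _ => rfl) (fun _ _ => rfl)) t)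
  obtain ⟨C, hC⟩ := hK.exists_bound_of_continuousOn (hcont.mono hKsub)
  refine ⟨C, fun x s hx hxs hst => ?_⟩
  have := hKc.norm_image_sub_le_of_norm_hasFDerivWithin_le
    (f := fun p : ℝ × ℝ => w p.1 p.2) (x := (0, s)) (y := (x, s))
    (fun p hp => ((hw.differentiableOn (by norm_num) p (hKsub hp)).hasFDerivWithinAt.mono hKsub))
    hC ⟨⟨le_rfl, hx.trans hxs⟩, hst⟩ ⟨⟨hx, hxs⟩, hst⟩
  simpa [hw0 s (hx.trans hxs), Prod.norm_def, abs_of_nonneg hx, max_eq_left hx] using this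

theorem w_diff (w : ℝ → ℝ → ℝ)
    (hw : ContDiffOn ℝ 2 (fun p : ℝ × ℝ => w p.1 p.2) Dset) (s : ℝ) (hs : 0 < s) :
    DifferentiableWithinAt ℝ (fun y => w y s) (Set.Ici 0) 0 := by
  have h1 : DifferentiableWithinAt ℝ (fun y => w y s) (Set.Icc 0 s) 0 := by
    have h := hw.differentiableOn (by norm_num) ((0:ℝ), s) ⟨le_rfl, hs.le⟩
    have h2 : DifferentiableWithinAt ℝ (fun y : ℝ => (y, s)) (Set.Icc 0 s) 0 := by fun_prop
    have h3 : MapsTo (fun y : ℝ => (y, s)) (Set.Icc 0 s) Dset := fun y hy => ⟨hy.1, hy.2⟩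
    exact DifferentiableWithinAt.comp (g := fun p : ℝ × ℝ => w p.1 p.2) (0:ℝ) h h2 h3
  exact h1.mono_of_mem_nhdsWithin (Icc_mem_nhdsGE hs)

theorem integral_part (f : ℝ → ℝ) (w : ℝ → ℝ → ℝ)
    (hf : ContinuousOn f (Set.Ici 0))
    (hw : ContDiffOn ℝ 2 (fun p : ℝ × ℝ => w p.1 p.2) Dset)
    (hw0 : ∀ s : ℝ, 0 ≤ s → w 0 s = 0) (t : ℝ) (ht : 0 < t) :
    HasDerivWithinAt (fun x => ∫ s in x..t, w x s * f (t - s))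
      (∫ s in (0:ℝ)..t, (derivWithin (fun y => w y s) (Set.Ici 0) 0) * f (t - s))
      (Set.Ici 0) 0 := by
  obtain ⟨C, hC⟩ := w_bound w hw hw0 t
  have hft : ContinuousOn (fun s => f (t - s)) (Set.Icc 0 t) :=
    hf.comp (by fun_prop) (fun s hs => by simpa using hs.2)
  obtain ⟨M, hM⟩ := isCompact_Icc.exists_bound_of_continuousOn hft
  have hC0 : 0 ≤ C := by
    have := (abs_nonneg _).trans (hC t t ht.le le_rfl le_rfl)
    exact nonneg_of_mul_nonneg_left this ht
  rw [← hasDerivWithinAt_Ioi_iff_Ici, hasDerivWithinAt_iff_tendsto_slope' (by simp)]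
  have hI0 : ∫ s in (0:ℝ)..t, w 0 s * f (t - s) = 0 := by
    rw [intervalIntegral.integral_congr (g := fun _ => (0:ℝ))]
    · simp
    · intro s hs
      rw [uIcc_of_le ht.le] at hs
      simp [hw0 s hs.1]
  have hev : ∀ᶠ x in nhdsWithin (0:ℝ) (Ioi 0), 0 < x ∧ x < t :=
    Ioo_mem_nhdsGT ht
  have key : Tendsto (fun x => ∫ s in (0:ℝ)..t,
      (Ioc x t).indicator (fun s => x⁻¹ * w x s * f (t - s)) s) (nhdsWithin (0:ℝ) (Ioi 0))
      (nhds (∫ s in (0:ℝ)..t, (derivWithin (fun y => w y s) (Set.Ici 0) 0) * f (t - s))) := by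
    apply intervalIntegral.tendsto_integral_filter_of_dominated_convergence (fun _ => C * M)
    · filter_upwards [hev] with x hx
      rw [aestronglyMeasurable_indicator_iff measurableSet_Ioc]
      refine AEStronglyMeasurable.mono_measure ?_
        (Measure.restrict_mono_measure Measure.restrict_le_self _)
      refine ContinuousOn.aestronglyMeasurable ?_ measurableSet_Ioc
      have hwc : ContinuousOn (fun s => w x s) (Ioc x t) :=
        hw.continuousOn.comp (f := fun s => (x, s)) (by fun_prop) (fun s hs => ⟨hx.1.le, hs.1.le⟩)
      exact (continuousOn_const.mul hwc).mul
        (hft.mono (fun s hs => ⟨(hx.1.trans hs.1).le, hs.2⟩))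
    · filter_upwards [hev] with x hx
      refine ae_of_all volume (fun s hs => ?_)
      rw [uIoc_of_le ht.le] at hs
      have hM' := hM s ⟨hs.1.le, hs.2⟩
      have hM0 := (norm_nonneg _).trans hM'
      by_cases hxs : s ∈ Ioc x t
      · rw [indicator_of_mem hxs, norm_mul]
        refine mul_le_mul ?_ hM' (norm_nonneg _) hC0
        rw [norm_mul, norm_inv, Real.norm_eq_abs, Real.norm_eq_abs, abs_of_pos hx.1,
          inv_mul_le_iff₀ hx.1, mul_comm]
        exact hC x s hx.1.le hxs.1.le hs.2
      · rw [indicator_of_notMem hxs, norm_zero]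
        positivity
    · exact intervalIntegrable_const
    · refine ae_of_all volume (fun s hs => ?_)
      rw [uIoc_of_le ht.le] at hs
      have hd := (w_diff w hw s hs.1).hasDerivWithinAt
      rw [← hasDerivWithinAt_Ioi_iff_Ici, hasDerivWithinAt_iff_tendsto_slope' (by simp)] at hd
      refine (hd.mul_const (f (t - s))).congr' ?_
      filter_upwards [Ioo_mem_nhdsGT hs.1] with x hx
      rw [indicator_of_mem (show s ∈ Ioc x t from ⟨hx.2, hs.2⟩)]
      simp [slope_def_field, hw0 s hs.1.le, div_eq_inv_mul]
  refine key.congr' ?_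
  filter_upwards [hev] with x hx
  rw [slope_def_field, hI0, sub_zero, sub_zero, div_eq_inv_mul,
    ← intervalIntegral.integral_const_mul, intervalIntegral.integral_of_le ht.le,
    intervalIntegral.integral_of_le hx.2.le, setIntegral_indicator measurableSet_Ioc,
    inter_eq_right.mpr (Ioc_subset_Ioc_left hx.1.le)]
  simp only [mul_assoc]

/-- The boundary derivative representation: for every `t > 0`, the one-sided derivative of
`x ↦ u(x,t)` at `x = 0` from the right equals `-f'(t) + ∫₀ᵗ w_x(0,s) f(t-s) ds`. -/
theorem response_representation (q f : ℝ → ℝ) (w : ℝ → ℝ → ℝ)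
    (hq : ContDiffOn ℝ 1 q (Set.Ici 0))
    (hf : ContDiffOn ℝ 2 f (Set.Ici 0))
    (hf0 : f 0 = 0) (hf'0 : derivWithin f (Set.Ici 0) 0 = 0)
    (hw : ContDiffOn ℝ 2 (fun p : ℝ × ℝ => w p.1 p.2) Dset)
    (hwpde : ∀ x s : ℝ, 0 < x → x < s →
      deriv (deriv (fun σ => w x σ)) s - deriv (deriv (fun y => w y s)) x
        + q x * w x s = 0)
    (hw0 : ∀ s : ℝ, 0 ≤ s → w 0 s = 0)
    (hwdiag : ∀ x : ℝ, 0 ≤ x → w x x = -(1/2) * ∫ α in (0:ℝ)..x, q α) :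
    ∀ t : ℝ, 0 < t →
      HasDerivWithinAt (fun x => usol f w x t)
        (-(deriv f t) + ∫ s in (0:ℝ)..t, (derivWithin (fun y => w y s) (Set.Ici 0) 0) * f (t - s))
        (Set.Ici 0) 0 := by
  intro t ht
  have hI := integral_part f w hf.continuousOn hw hw0 t ht
  have hfd : HasDerivAt f (deriv f t) (t - 0) := by
    rw [sub_zero]
    exact ((hf.differentiableOn (by norm_num) t ht.le).differentiableAt
      (Ici_mem_nhds ht)).hasDerivAt
  have h1 : HasDerivAt (fun x => f (t - x)) (-(deriv f t)) 0 := by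
    have h2 : HasDerivAt (fun x : ℝ => t - x) (-1) 0 := by
      simpa using (hasDerivAt_id (0:ℝ)).const_sub t
    simpa [Function.comp_def] using hfd.comp (0:ℝ) h2
  refine (h1.hasDerivWithinAt.add hI).congr_of_eventuallyEq ?_ ?_
  · filter_upwards [Icc_mem_nhdsGE ht] with x hx
    simp [usol, hx.2]
  · simp [usol, ht.le]
end

section
/- Let q be continuously differentiable on [0,∞), let v be the unique continuous solution of the Goursat integral equation, set w(x,s) = v(s−x, s+x) for 0 ≤ x ≤ s and w(x,s) = 0 for s < x, let r(t) = w_x(0,t) (the derivative of x ↦ w(x,t) at x = 0 from the right), and let p(θ) = (1/2)∫₀^{θ} r(ζ) dζ for θ ≥ 0. Then for all 0 ≤ a ≤ b the kernel identity w(a,b) + ∫₀^{a} w(x,a) w(x,b) dx = p(a+b) − p(b−a) holds. -/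
open MeasureTheory Set Filter

/-- `w(x,s) = v(s-x,s+x)` for `0 ≤ x ≤ s`, extended by `0` for `s < x`. -/
noncomputable def wof (v : ℝ → ℝ → ℝ) (x s : ℝ) : ℝ :=
  if x ≤ s then v (s - x) (s + x) else 0

/-- The response function `r(t) = w_x(0,t)` (one-sided derivative from the right). -/
noncomputable def rof (v : ℝ → ℝ → ℝ) (t : ℝ) : ℝ :=
  derivWithin (fun x => wof v x t) (Set.Ici 0) 0

/-- `p(θ) = (1/2)∫₀^θ r(ζ) dζ`. -/
noncomputable def pof (v : ℝ → ℝ → ℝ) (θ : ℝ) : ℝ :=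
  (1/2) * ∫ ζ in (0:ℝ)..θ, rof v ζ


/-- Moving endpoint, with the endpoint meeting the base point. -/
lemma leib_end (f : ℝ → ℝ → ℝ) (hf : Continuous (Function.uncurry f)) (u : ℝ → ℝ) (u' t₀ : ℝ)
    (hu : HasDerivAt u u' t₀) (huc : Continuous u) :
    HasDerivAt (fun t => ∫ y in (u t₀)..(u t), f t y) (u' * f t₀ (u t₀)) t₀ := by
  set c := u t₀ with hc
  let Φ : ℝ → ℝ := fun t => ∫ θ in (0:ℝ)..1, f t (c + (u t - c) * θ)
  have hΦ : Continuous Φ := by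
    apply intervalIntegral.continuous_parametric_intervalIntegral_of_continuous'
    exact hf.comp (by fun_prop : Continuous fun p : ℝ × ℝ => (p.1, c + (u p.1 - c) * p.2))
  have hΦ0 : Φ t₀ = f t₀ c := by simp [Φ, ← hc]
  have he : (fun t => ∫ y in c..(u t), f t y) = fun t => (u t - c) * Φ t := by
    funext t
    have := intervalIntegral.smul_integral_comp_add_mul (f t) (u t - c) c (a := 0) (b := 1)
    simp only [smul_eq_mul] at this
    simp only [Φ]
    rw [this]
    simp
  rw [he, ← hΦ0]
  rw [hasDerivAt_iff_tendsto_slope] at hu ⊢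
  have h2 := hu.mul ((hΦ.tendsto t₀).mono_left (nhdsWithin_le_nhds (s := {t₀}ᶜ)))
  refine h2.congr fun t => ?_
  simp only [slope, vsub_eq_sub, smul_eq_mul, ← hc]
  ring

lemma leib_param (f f' : ℝ → ℝ → ℝ) (hf : Continuous (Function.uncurry f))
    (hf' : Continuous (Function.uncurry f'))
    (hd : ∀ t y, HasDerivAt (fun t => f t y) (f' t y) t) (a b t₀ : ℝ) :
    HasDerivAt (fun t => ∫ y in a..b, f t y) (∫ y in a..b, f' t₀ y) t₀ := by
  have hcomp : IsCompact (Metric.closedBall t₀ 1 ×ˢ uIcc a b) :=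
    (isCompact_closedBall t₀ 1).prod isCompact_uIcc
  obtain ⟨C, hC⟩ := hcomp.exists_bound_of_continuousOn hf'.continuousOn
  have hs : ∀ t, Continuous (f t) := fun t => hf.comp (by fun_prop : Continuous fun y : ℝ => (t, y))
  have hs' : ∀ t, Continuous (f' t) :=
    fun t => hf'.comp (by fun_prop : Continuous fun y : ℝ => (t, y))
  refine (intervalIntegral.hasDerivAt_integral_of_dominated_loc_of_deriv_le
    (bound := fun _ => C) (Metric.closedBall_mem_nhds t₀ one_pos) (Eventually.of_forall fun t =>
      (hs t).aestronglyMeasurable) ((hs t₀).intervalIntegrable _ _)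
    ((hs' t₀).aestronglyMeasurable) (Eventually.of_forall fun y hy t ht => ?_)
    intervalIntegrable_const (Eventually.of_forall fun y hy t ht => hd t y)).2
  exact hC (t, y) ⟨ht, uIoc_subset_uIcc hy⟩

lemma leib (f f' : ℝ → ℝ → ℝ) (hf : Continuous (Function.uncurry f))
    (hf' : Continuous (Function.uncurry f'))
    (hd : ∀ t y, HasDerivAt (fun t => f t y) (f' t y) t) (l u : ℝ → ℝ) (l' u' t₀ : ℝ)
    (hl : HasDerivAt l l' t₀) (hlc : Continuous l)
    (hu : HasDerivAt u u' t₀) (huc : Continuous u) :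
    HasDerivAt (fun t => ∫ y in (l t)..(u t), f t y)
      (u' * f t₀ (u t₀) - l' * f t₀ (l t₀) + ∫ y in (l t₀)..(u t₀), f' t₀ y) t₀ := by
  have h := ((leib_end f hf u u' t₀ hu huc).sub (leib_end f hf l l' t₀ hl hlc)).add
    (leib_param f f' hf hf' hd (l t₀) (u t₀) t₀)
  refine h.congr_of_eventuallyEq (Eventually.of_forall fun t => ?_)
  have hi : ∀ a b, IntervalIntegrable (f t) volume a b := fun a b =>
    (hf.comp (by fun_prop : Continuous fun y : ℝ => (t, y))).intervalIntegrable _ _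
  simp only [Pi.add_apply, Pi.sub_apply]
  rw [← intervalIntegral.integral_add_adjacent_intervals (hi (l t) (l t₀)) (hi _ (u t)),
    ← intervalIntegral.integral_add_adjacent_intervals (hi (l t₀) (u t₀)) (hi _ (u t)),
    intervalIntegral.integral_symm (l t₀) (l t)]
  ring

lemma core (V A k : ℝ → ℝ → ℝ) (m : ℝ → ℝ) (hV : Continuous (Function.uncurry V))
    (hA : Continuous (Function.uncurry A)) (hk : Continuous (Function.uncurry k))
    (hVA : ∀ ξ η, HasDerivAt (fun η => V ξ η) (A ξ η) η)
    (hAk : ∀ ξ η, HasDerivAt (fun ξ => A ξ η) (k ξ η) ξ)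
    (hdiag : ∀ ξ, V ξ ξ = 0)
    (hkV : ∀ ξ η, 0 ≤ ξ → ξ ≤ η → k ξ η = m ((η - ξ) / 2) * V ξ η)
    (hA0 : ∀ η, 0 ≤ η → A 0 η = m (η / 2)) (ξ η : ℝ) (hξ : 0 ≤ ξ) (hξη : ξ ≤ η) :
    V ξ η + (∫ z in (0:ℝ)..((η - ξ) / 2), V z (η - ξ - z) * V (ξ + z) (η - z))
      = ∫ t in ξ..η, A t t := by
  have cV : ∀ {X : Type} [TopologicalSpace X] {f g : X → ℝ}, Continuous f → Continuous g →
      Continuous fun x => V (f x) (g x) := fun hf hg => hV.comp (hf.prodMk hg)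
  have cA : ∀ {X : Type} [TopologicalSpace X] {f g : X → ℝ}, Continuous f → Continuous g →
      Continuous fun x => A (f x) (g x) := fun hf hg => hA.comp (hf.prodMk hg)
  have ck : ∀ {X : Type} [TopologicalSpace X] {f g : X → ℝ}, Continuous f → Continuous g →
      Continuous fun x => k (f x) (g x) := fun hf hg => hk.comp (hf.prodMk hg)
  let G : ℝ → ℝ → ℝ := fun ξ η =>
    V ξ η + ∫ z in (0:ℝ)..((η - ξ) / 2), V z (η - ξ - z) * V (ξ + z) (η - z)
  let T1 : ℝ → ℝ → ℝ := fun ξ η =>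
    ∫ y in ((η - ξ) / 2)..(η - ξ), A (η - ξ - y) y * V (η - y) (ξ + y)
  let T2 : ℝ → ℝ → ℝ := fun ξ η =>
    ∫ u in ((η + ξ) / 2)..η, V (η - u) (u - ξ) * A (η + ξ - u) u
  let H : ℝ → ℝ → ℝ := fun ξ η => A ξ η + (T1 ξ η + T2 ξ η)
  -- derivative of `G` in `η`
  have hG : ∀ ξ η, HasDerivAt (fun η => G ξ η) (H ξ η) η := by
    intro ξ η
    have h1 := leib (fun η z => V z (η - ξ - z) * V (ξ + z) (η - z))
      (fun η z => A z (η - ξ - z) * V (ξ + z) (η - z) + V z (η - ξ - z) * A (ξ + z) (η - z))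
      ((cV (by fun_prop) (by fun_prop)).mul (cV (by fun_prop) (by fun_prop)))
      (((cA (by fun_prop) (by fun_prop)).mul (cV (by fun_prop) (by fun_prop))).add
        ((cV (by fun_prop) (by fun_prop)).mul (cA (by fun_prop) (by fun_prop))))
      (fun η z => by
        have e1 := (hVA z (η - ξ - z)).comp η (((hasDerivAt_id η).sub_const ξ).sub_const z)
        have e2 := (hVA (ξ + z) (η - z)).comp η ((hasDerivAt_id η).sub_const z)
        exact (e1.mul e2).congr_deriv (by simp))
      (fun _ => 0) (fun η => (η - ξ) / 2) 0 (1 / 2) η (hasDerivAt_const _ _) (by fun_prop)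
      (((hasDerivAt_id η).sub_const ξ).div_const 2) (by fun_prop)
    have h2 := (hVA ξ η).add h1
    refine h2.congr_deriv ?_
    simp only [H]
    congr 1
    have ed : η - ξ - (η - ξ) / 2 = (η - ξ) / 2 := by ring
    rw [ed, hdiag]
    have s1 : T1 ξ η = ∫ z in (0:ℝ)..((η - ξ) / 2), A z (η - ξ - z) * V (ξ + z) (η - z) := by
      have := intervalIntegral.integral_comp_sub_left
        (fun z => A z (η - ξ - z) * V (ξ + z) (η - z)) (η - ξ)
        (a := (η - ξ) / 2) (b := η - ξ)
      rw [ed, sub_self] at this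
      rw [← this]
      apply intervalIntegral.integral_congr
      intro y _
      simp only
      congr 2 <;> ring
    have s2 : T2 ξ η = ∫ z in (0:ℝ)..((η - ξ) / 2), V z (η - ξ - z) * A (ξ + z) (η - z) := by
      have := intervalIntegral.integral_comp_sub_left
        (fun z => V z (η - ξ - z) * A (ξ + z) (η - z)) η
        (a := (η + ξ) / 2) (b := η)
      rw [show η - (η + ξ) / 2 = (η - ξ) / 2 by ring, sub_self] at this
      rw [← this]
      apply intervalIntegral.integral_congr
      intro y _
      simp only
      congr 2 <;> ring
    rw [s1, s2, ← intervalIntegral.integral_add]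
    · ring
    · exact ((cA (by fun_prop) (by fun_prop)).mul
        (cV (by fun_prop) (by fun_prop))).intervalIntegrable _ _
    · exact ((cV (by fun_prop) (by fun_prop)).mul
        (cA (by fun_prop) (by fun_prop))).intervalIntegrable _ _
  -- derivative of `H` in `ξ` vanishes on `D`
  have hH : ∀ ξ η, 0 ≤ ξ → ξ ≤ η → HasDerivAt (fun ξ => H ξ η) 0 ξ := by
    intro ξ η hξ hξη
    have h1 := leib (fun ξ y => A (η - ξ - y) y * V (η - y) (ξ + y))
      (fun ξ y => -k (η - ξ - y) y * V (η - y) (ξ + y) + A (η - ξ - y) y * A (η - y) (ξ + y))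
      ((cA (by fun_prop) (by fun_prop)).mul (cV (by fun_prop) (by fun_prop)))
      (((ck (by fun_prop) (by fun_prop)).neg.mul (cV (by fun_prop) (by fun_prop))).add
        ((cA (by fun_prop) (by fun_prop)).mul (cA (by fun_prop) (by fun_prop))))
      (fun ξ y => by
        have e1 := (hAk (η - ξ - y) y).comp ξ (((hasDerivAt_id ξ).const_sub η).sub_const y)
        have e2 := (hVA (η - y) (ξ + y)).comp ξ ((hasDerivAt_id ξ).add_const y)
        exact (e1.mul e2).congr_deriv (by simp))
      (fun ξ => (η - ξ) / 2) (fun ξ => η - ξ) (-1 / 2) (-1) ξ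
      (((hasDerivAt_id ξ).const_sub η).div_const 2) (by fun_prop)
      ((hasDerivAt_id ξ).const_sub η) (by fun_prop)
    have h2 := leib (fun ξ u => V (η - u) (u - ξ) * A (η + ξ - u) u)
      (fun ξ u => -A (η - u) (u - ξ) * A (η + ξ - u) u + V (η - u) (u - ξ) * k (η + ξ - u) u)
      ((cV (by fun_prop) (by fun_prop)).mul (cA (by fun_prop) (by fun_prop)))
      (((cA (by fun_prop) (by fun_prop)).neg.mul (cA (by fun_prop) (by fun_prop))).add
        ((cV (by fun_prop) (by fun_prop)).mul (ck (by fun_prop) (by fun_prop))))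
      (fun ξ u => by
        have e1 := (hVA (η - u) (u - ξ)).comp ξ ((hasDerivAt_id ξ).const_sub u)
        have e2 := (hAk (η + ξ - u) u).comp ξ (((hasDerivAt_id ξ).const_add η).sub_const u)
        exact (e1.mul e2).congr_deriv (by simp))
      (fun ξ => (η + ξ) / 2) (fun _ => η) (1 / 2) 0 ξ
      (((hasDerivAt_id ξ).const_add η).div_const 2) (by fun_prop)
      (hasDerivAt_const _ _) (by fun_prop)
    have h3 := (hAk ξ η).add (h1.add h2)
    refine h3.congr_deriv ?_
    have s2 : (∫ u in ((η + ξ) / 2)..η,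
        (-A (η - u) (u - ξ) * A (η + ξ - u) u + V (η - u) (u - ξ) * k (η + ξ - u) u))
        = ∫ y in ((η - ξ) / 2)..(η - ξ), (-A (η - ξ - y) y * A (η - y) (ξ + y)
          + V (η - ξ - y) y * k (η - y) (ξ + y)) := by
      have := intervalIntegral.integral_comp_sub_right
        (fun y => (-A (η - ξ - y) y * A (η - y) (ξ + y)
          + V (η - ξ - y) y * k (η - y) (ξ + y))) ξ
        (a := (η + ξ) / 2) (b := η)
      rw [show (η + ξ) / 2 - ξ = (η - ξ) / 2 by ring] at this
      rw [← this]
      apply intervalIntegral.integral_congr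
      intro y _
      simp only
      rw [show η - ξ - (y - ξ) = η - y by ring, show η - (y - ξ) = η + ξ - y by ring,
        show ξ + (y - ξ) = y by ring]
    have s3 : (∫ y in ((η - ξ) / 2)..(η - ξ),
        (-k (η - ξ - y) y * V (η - y) (ξ + y) + A (η - ξ - y) y * A (η - y) (ξ + y)))
        + (∫ y in ((η - ξ) / 2)..(η - ξ), (-A (η - ξ - y) y * A (η - y) (ξ + y)
          + V (η - ξ - y) y * k (η - y) (ξ + y))) = 0 := by
      rw [← intervalIntegral.integral_add]
      · rw [← intervalIntegral.integral_zero (a := (η - ξ) / 2) (b := η - ξ) (μ := volume)]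
        apply intervalIntegral.integral_congr
        intro y hy
        rw [uIcc_of_le (by linarith)] at hy
        obtain ⟨hy1, hy2⟩ := hy
        simp only
        rw [hkV (η - ξ - y) y (by linarith) (by linarith),
          hkV (η - y) (ξ + y) (by linarith) (by linarith),
          show (ξ + y - (η - y)) / 2 = (y - (η - ξ - y)) / 2 by ring]
        ring
      · exact (((ck (by fun_prop) (by fun_prop)).neg.mul (cV (by fun_prop) (by fun_prop))).add
          ((cA (by fun_prop) (by fun_prop)).mul
            (cA (by fun_prop) (by fun_prop)))).intervalIntegrable _ _
      · exact (((cA (by fun_prop) (by fun_prop)).neg.mul (cA (by fun_prop) (by fun_prop))).add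
          ((cV (by fun_prop) (by fun_prop)).mul
            (ck (by fun_prop) (by fun_prop)))).intervalIntegrable _ _
    rw [s2]
    have d1 : V (η - (η - ξ) / 2) (ξ + (η - ξ) / 2) = 0 := by
      rw [show η - (η - ξ) / 2 = ξ + (η - ξ) / 2 by ring, hdiag]
    have d2 : V (η - (η + ξ) / 2) ((η + ξ) / 2 - ξ) = 0 := by
      rw [show η - (η + ξ) / 2 = (η + ξ) / 2 - ξ by ring, hdiag]
    rw [d1, d2, sub_self, hA0 (η - ξ) (by linarith), hkV ξ η hξ hξη,
      show η - (η - ξ) = ξ by ring, show ξ + (η - ξ) = η by ring]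
    linear_combination s3
  have hH0 : ∀ ξ η, 0 ≤ ξ → ξ ≤ η → H ξ η = H 0 η := by
    intro ξ η hξ hξη
    exact constant_of_has_deriv_right_zero (f := fun ξ => H ξ η) (a := 0) (b := η)
      (fun x hx => (hH x η hx.1 hx.2).continuousAt.continuousWithinAt)
      (fun x hx => (hH x η hx.1 hx.2.le).hasDerivWithinAt) ξ ⟨hξ, hξη⟩
  have hHd : ∀ t, 0 ≤ t → H 0 t = A t t := by
    intro t ht
    rw [← hH0 t t ht le_rfl]
    simp [H, T1, T2]
  have hGd : G ξ ξ = 0 := by simp [G, hdiag]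
  have hcd : Continuous fun t => A t t := cA continuous_id continuous_id
  have := intervalIntegral.integral_eq_sub_of_hasDerivAt (f := fun s => G ξ s)
    (f' := fun s => H ξ s) (a := ξ) (b := η) (fun s _ => hG ξ s) (by
      refine (hcd.intervalIntegrable ξ η).congr fun s hs => ?_
      rw [uIoc_of_le hξη] at hs
      rw [hH0 ξ s hξ hs.1.le, hHd s (hξ.trans hs.1.le)])
  rw [hGd, sub_zero] at this
  rw [show V ξ η + (∫ z in (0:ℝ)..((η - ξ) / 2), V z (η - ξ - z) * V (ξ + z) (η - z))
    = G ξ η from rfl, ← this]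
  apply intervalIntegral.integral_congr
  intro s hs
  rw [uIcc_of_le hξη] at hs
  simp only
  rw [hH0 ξ s hξ hs.1, hHd s (hξ.trans hs.1)]

/-- The kernel identity: for all `0 ≤ a ≤ b`,
`w(a,b) + ∫₀^a w(x,a) w(x,b) dx = p(a+b) - p(b-a)`. -/
theorem kernel_identity (q : ℝ → ℝ) (hq : ContDiffOn ℝ 1 q (Set.Ici 0))
    (v : ℝ → ℝ → ℝ)
    (hvc : ContinuousOn (fun p : ℝ × ℝ => v p.1 p.2) Dset)
    (hv : ∀ p ∈ Dset, v p.1 p.2 = Qker q p.1 p.2 - Kop q v p.1 p.2) :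
    ∀ a b : ℝ, 0 ≤ a → a ≤ b →
      wof v a b + ∫ x in (0:ℝ)..a, wof v x a * wof v x b
        = pof v (a + b) - pof v (b - a) := by

  intro a b ha hab
  let qt : ℝ → ℝ := fun x => q (max 0 x)
  have hqt : Continuous qt := hq.continuousOn.comp_continuous (by fun_prop) (fun x => by simp)
  let vt : ℝ → ℝ → ℝ := fun ξ η => v (max 0 ξ) (max (max 0 ξ) η)
  have hvt : Continuous (Function.uncurry vt) :=
    hvc.comp_continuous
      (f := fun p : ℝ × ℝ => (max 0 p.1, max (max 0 p.1) p.2)) (by fun_prop)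
      (fun p => ⟨le_max_left _ _, le_max_left _ _⟩)
  have vt_eq : ∀ ξ η, 0 ≤ ξ → ξ ≤ η → vt ξ η = v ξ η := by
    intro ξ η h1 h2
    simp only [vt, max_eq_right h1, max_eq_right h2]
  have qt_eq : ∀ x, 0 ≤ x → qt x = q x := by
    intro x hx
    simp only [qt, max_eq_right hx]
  let k : ℝ → ℝ → ℝ := fun ξ η => -(1/4) * (qt ((η - ξ) / 2) * vt ξ η)
  have hk : Continuous (Function.uncurry k) := by
    have : Continuous fun p : ℝ × ℝ => -(1/4) * (qt ((p.2 - p.1) / 2) * vt p.1 p.2) :=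
      continuous_const.mul ((hqt.comp (by fun_prop)).mul hvt)
    exact this
  let A : ℝ → ℝ → ℝ := fun ξ η => -(1/4) * qt (η / 2) + ∫ s in (0:ℝ)..ξ, k s η
  have hA : Continuous (Function.uncurry A) := by
    have h1 : Continuous fun p : ℝ × ℝ => -(1/4) * qt (p.2 / 2) :=
      continuous_const.mul (hqt.comp (by fun_prop))
    have h2 : Continuous fun p : ℝ × ℝ => ∫ s in (0:ℝ)..p.1, k s p.2 := by
      apply intervalIntegral.continuous_parametric_intervalIntegral_of_continuous
      · exact hk.comp (by fun_prop : Continuous fun x : (ℝ × ℝ) × ℝ => (x.2, x.1.2))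
      · fun_prop
    exact h1.add h2
  have cA : ∀ {X : Type} [TopologicalSpace X] {f g : X → ℝ}, Continuous f → Continuous g →
      Continuous fun x => A (f x) (g x) := fun hf hg => hA.comp (hf.prodMk hg)
  have ck : ∀ {X : Type} [TopologicalSpace X] {f g : X → ℝ}, Continuous f → Continuous g →
      Continuous fun x => k (f x) (g x) := fun hf hg => hk.comp (hf.prodMk hg)
  let V : ℝ → ℝ → ℝ := fun ξ η => ∫ s in ξ..η, A ξ s
  have hAk : ∀ ξ η, HasDerivAt (fun ξ => A ξ η) (k ξ η) ξ := by
    intro ξ η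
    exact ((ck continuous_id continuous_const).integral_hasStrictDerivAt 0 ξ).hasDerivAt.const_add _
  have hVA : ∀ ξ η, HasDerivAt (fun η => V ξ η) (A ξ η) η := by
    intro ξ η
    exact ((cA continuous_const continuous_id).integral_hasStrictDerivAt ξ η).hasDerivAt
  have hdiag : ∀ ξ, V ξ ξ = 0 := fun ξ => by simp [V]
  have hV : Continuous (Function.uncurry V) := by
    have he : Function.uncurry V = fun p : ℝ × ℝ =>
        (∫ s in (0:ℝ)..p.2, A p.1 s) - ∫ s in (0:ℝ)..p.1, A p.1 s := by
      funext p
      have hc : Continuous (A p.1) := cA continuous_const continuous_id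
      rw [intervalIntegral.integral_interval_sub_left (hc.intervalIntegrable _ _)
        (hc.intervalIntegrable _ _)]
      rfl
    rw [he]
    have hA' : Continuous (Function.uncurry fun (p : ℝ × ℝ) (s : ℝ) => A p.1 s) :=
      hA.comp (by fun_prop : Continuous fun x : (ℝ × ℝ) × ℝ => (x.1.1, x.2))
    exact (intervalIntegral.continuous_parametric_intervalIntegral_of_continuous hA'
      continuous_snd).sub
      (intervalIntegral.continuous_parametric_intervalIntegral_of_continuous hA' continuous_fst)
  have hvV : ∀ ξ η, 0 ≤ ξ → ξ ≤ η → v ξ η = V ξ η := by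
    intro ξ η h1 h2
    have e := hv (ξ, η) ⟨h1, h2⟩
    simp only at e
    rw [e]
    have hQ : Qker q ξ η = ∫ s in ξ..η, -(1/4) * qt (s / 2) := by
      rw [Qker, intervalIntegral.integral_const_mul]
      have := intervalIntegral.integral_comp_div qt (two_ne_zero (α := ℝ)) (a := ξ) (b := η)
      rw [this, smul_eq_mul]
      have : (∫ x in (ξ/2)..(η/2), q x) = ∫ x in (ξ/2)..(η/2), qt x := by
        apply intervalIntegral.integral_congr
        intro x hx
        rw [uIcc_of_le (by linarith)] at hx
        exact (qt_eq x (by linarith [hx.1])).symm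
      rw [this]
      ring
    have hK : - Kop q v ξ η = ∫ s in ξ..η, ∫ t in (0:ℝ)..ξ, k t s := by
      rw [← intervalIntegral_intervalIntegral_swap (F := k) (a := 0) (b := ξ) (c := ξ) (d := η)]
      · rw [Kop, neg_mul_eq_neg_mul, ← intervalIntegral.integral_const_mul]
        apply intervalIntegral.integral_congr
        intro t ht
        rw [uIcc_of_le h1] at ht
        simp only
        rw [← intervalIntegral.integral_const_mul]
        apply intervalIntegral.integral_congr
        intro s hs
        rw [uIcc_of_le h2] at hs
        simp only [k]
        rw [qt_eq _ (by linarith [hs.1, ht.2]), vt_eq _ _ ht.1 (by linarith [hs.1, ht.2])]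
      · have hc : IsCompact (uIcc 0 ξ ×ˢ uIcc ξ η) := isCompact_uIcc.prod isCompact_uIcc
        exact (hk.continuousOn.integrableOn_compact hc).mono_set
          (prod_mono uIoc_subset_uIcc uIoc_subset_uIcc)
    rw [sub_eq_add_neg, hK, hQ, ← intervalIntegral.integral_add]
    · exact (continuous_const.mul (hqt.comp (by fun_prop))).intervalIntegrable _ _
    · apply Continuous.intervalIntegrable
      apply intervalIntegral.continuous_parametric_intervalIntegral_of_continuous'
      exact ck continuous_snd continuous_fst
  have hmain := core V A k (fun x => -(1/4) * qt x) hV hA hk hVA hAk hdiag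
    (by
      intro ξ η h1 h2
      simp only [k]
      rw [vt_eq ξ η h1 h2, hvV ξ η h1 h2]
      ring)
    (by intro η _; simp [A]) (b - a) (b + a) (by linarith) (by linarith)
  have hr : ∀ t, 0 < t → rof v t = 2 * A t t := by
    intro t ht
    have hd : HasDerivAt (fun x => ∫ s in (t - x)..(t + x), A (t - x) s) (2 * A t t) 0 := by
      have h := leib (fun x s => A (t - x) s) (fun x s => - k (t - x) s)
        (cA (by fun_prop) (by fun_prop)) (ck (by fun_prop) (by fun_prop)).neg
        (fun x s => ((hAk (t - x) s).comp x ((hasDerivAt_id x).const_sub t)).congr_deriv (by simp))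
        (fun x => t - x) (fun x => t + x) (-1) 1 0
        ((hasDerivAt_id 0).const_sub t) (by fun_prop)
        ((hasDerivAt_id 0).const_add t) (by fun_prop)
      refine h.congr_deriv ?_
      simp
      ring
    have hw : HasDerivWithinAt (fun x => wof v x t) (2 * A t t) (Ici 0) 0 := by
      refine hd.hasDerivWithinAt.congr_of_eventuallyEq ?_ ?_
      · filter_upwards [self_mem_nhdsWithin, mem_nhdsWithin_of_mem_nhds (Iio_mem_nhds ht)]
          with x hx hx'
        have hx0 : (0:ℝ) ≤ x := hx
        have hxt : x < t := hx'
        simp only [wof, if_pos hxt.le]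
        exact hvV _ _ (by linarith) (by linarith)
      · simp only [wof, if_pos ht.le]
        exact hvV _ _ (by linarith) (by linarith)
    exact hw.derivWithin (uniqueDiffOn_Ici (0:ℝ) 0 self_mem_Ici)
  have hp : ∀ θ, 0 ≤ θ → pof v θ = ∫ t in (0:ℝ)..θ, A t t := by
    intro θ hθ
    rw [pof, ← intervalIntegral.integral_const_mul]
    apply intervalIntegral.integral_congr_ae
    refine Eventually.of_forall fun t ht => ?_
    rw [uIoc_of_le hθ] at ht
    rw [hr t ht.1]
    ring
  have hcd : Continuous fun t => A t t := cA continuous_id continuous_id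
  rw [hp (a + b) (by linarith), hp (b - a) (by linarith),
    intervalIntegral.integral_interval_sub_left (hcd.intervalIntegrable _ _)
      (hcd.intervalIntegrable _ _), add_comm a b, ← hmain]
  congr 1
  · rw [wof, if_pos hab, hvV _ _ (by linarith) (by linarith)]
  · have := intervalIntegral.integral_comp_sub_left
      (fun z => V z (b + a - (b - a) - z) * V (b - a + z) (b + a - z)) a (a := 0) (b := a)
    rw [sub_self, sub_zero] at this
    rw [show (b + a - (b - a)) / 2 = a by ring, ← this]
    apply intervalIntegral.integral_congr
    intro x hx
    rw [uIcc_of_le ha] at hx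
    obtain ⟨hx0, hx1⟩ := hx
    simp only [wof]
    rw [if_pos hx1, if_pos (hx1.trans hab), hvV _ _ (by linarith) (by linarith),
      hvV _ _ (by linarith) (by linarith)]
    congr 2 <;> ring
end
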